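/- For every natural number n, if the edges of the complete graph K_n are coloured so that the colouring is a 2-mean colouring, i.e., the sum over all vertices v of the number of distinct colours appearing on edges incident to v is at most 2n, then the vertex set of K_n can be covered by two disjoint monochromatic cycles of different colours. -/

import Mathlib

/-- `S` is the vertex set of a monochromatic cycle of colour `col` in the complete graph
`K_n` coloured by `χ`; the empty set, single vertices and single edges count as degenerate
cycles (the empty set being a cycle of any colour). -/
def IsMonoCycle {n : ℕ} (χ : Fin n → Fin n → ℕ) (col : ℕ) (S : Finset (Fin n)) : Prop :=
  S = ∅ ∨
  (∃ v, S = {v}) ∨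
  (∃ v w : Fin n, v ≠ w ∧ S = {v, w} ∧ χ v w = col) ∨
  (∃ (v : Fin n) (p : (⊤ : SimpleGraph (Fin n)).Walk v v),
    p.IsCycle ∧ p.support.toFinset = S ∧ ∀ x y : Fin n, s(x, y) ∈ p.edges → χ x y = col)

namespace BT

inductive MP {V : Type*} [DecidableEq V] (R : V → V → Prop) : Finset V → V → V → Prop
  | single (a : V) : MP R {a} a a
  | cons {a b c : V} {S : Finset V} : a ∉ S → R a b → MP R S b c → MP R (insert a S) a c

section basic
variable {V : Type*} [DecidableEq V] {R : V → V → Prop}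

lemma MP.left {S : Finset V} {a b : V} (h : MP R S a b) : a ∈ S := by
  cases h <;> simp

lemma MP.right {S : Finset V} {a b : V} (h : MP R S a b) : b ∈ S := by
  induction h with
  | single a => simp
  | cons h1 h2 h3 ih => exact Finset.mem_insert_of_mem ih

lemma MP.congr {S T : Finset V} {a b : V} (h : MP R S a b) (e : S = T) : MP R T a b := e ▸ h

lemma MP.append {S T : Finset V} {a b c d : V} (h : MP R S a b) (h' : MP R T c d)
    (hd : Disjoint S T) (hr : R b c) : MP R (S ∪ T) a d := by
  induction h with
  | single a =>
    rw [← Finset.insert_eq]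
    exact MP.cons (by simpa using hd) hr h'
  | cons h1 h2 h3 ih =>
    rw [Finset.disjoint_insert_left] at hd
    rw [Finset.insert_union]
    refine MP.cons ?_ h2 (ih hd.2 hr)
    simp [h1, hd.1]

lemma MP.snoc {S : Finset V} {a b c : V} (h : MP R S a b) (hc : c ∉ S) (hr : R b c) :
    MP R (insert c S) a c := by
  refine (h.append (MP.single c) (by simpa using hc) hr).congr ?_
  ext; simp

lemma MP.reverse (hs : ∀ a b, R a b → R b a) {S : Finset V} {a b : V} (h : MP R S a b) :
    MP R S b a := by
  induction h with
  | single a => exact MP.single a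
  | cons h1 h2 h3 ih => exact ih.snoc h1 (hs _ _ h2)

lemma MP.uncons {S : Finset V} {a b : V} (h : MP R S a b) :
    (S = {a} ∧ b = a) ∨ ∃ c T, a ∉ T ∧ S = insert a T ∧ R a c ∧ MP R T c b := by
  cases h with
  | single a => left; simp
  | cons h1 h2 h3 => right; exact ⟨_, _, h1, rfl, h2, h3⟩

lemma MP.unconsNe {S : Finset V} {a b : V} (h : MP R S a b) (hab : a ≠ b) :
    ∃ c T, a ∉ T ∧ S = insert a T ∧ R a c ∧ MP R T c b := by
  rcases h.uncons with h | h
  · exact absurd h.2.symm hab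
  · exact h

lemma MP.map {W : Type*} [DecidableEq W] {R' : W → W → Prop} (f : V → W)
    (hf : Function.Injective f)
    {S : Finset V} {a b : V} (h : MP R S a b) (hR : ∀ x ∈ S, ∀ y ∈ S, R x y → R' (f x) (f y)) :
    MP R' (S.image f) (f a) (f b) := by
  induction h with
  | single a => simpa using MP.single (f a)
  | cons h1 h2 h3 ih =>
    rw [Finset.image_insert]
    refine MP.cons ?_ (hR _ (by simp) _ (by simp [h3.left]) h2) (ih ?_)
    · simpa [hf.eq_iff] using h1
    · intro x hx y hy; exact hR x (by simp [hx]) y (by simp [hy])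

/-- cyclic structure -/
def Cyc (R : V → V → Prop) (S : Finset V) : Prop :=
  S = ∅ ∨ ∃ a b, MP R S a b ∧ R b a

lemma MP.cyc {S : Finset V} {a b : V} (h : MP R S a b) (hr : R b a) : Cyc R S :=
  Or.inr ⟨a, b, h, hr⟩

lemma Cyc.congr {S T : Finset V} (h : Cyc R S) (e : S = T) : Cyc R T := e ▸ h

/-- rotation -/
lemma MP.split {S : Finset V} {a b v : V} (h : MP R S a b) (hv : v ∈ S) :
    (v = a) ∨ ∃ S1 S2 u, MP R S1 a u ∧ MP R S2 v b ∧ R u v ∧ Disjoint S1 S2 ∧ S1 ∪ S2 = S := by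
  induction h with
  | single a => left; simpa using hv
  | @cons a b c S h1 h2 h3 ih =>
    by_cases hva : v = a
    · exact Or.inl hva
    right
    have hv' : v ∈ S := by simpa [hva] using hv
    rcases ih hv' with rfl | ⟨S1, S2, u, k1, k2, k3, k4, k5⟩
    · exact ⟨{a}, S, a, MP.single a, h3, h2, by simpa using h1, (Finset.insert_eq a S).symm⟩
    · refine ⟨insert a S1, S2, u, MP.cons (fun h => h1 (k5 ▸ Finset.mem_union_left _ h)) h2 k1,
        k2, k3, ?_, ?_⟩
      · rw [Finset.disjoint_insert_left]
        exact ⟨fun h => h1 (k5 ▸ Finset.mem_union_right _ h), k4⟩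
      · rw [Finset.insert_union, k5]

lemma Cyc.rotate {S : Finset V} (h : Cyc R S) {v : V} (hv : v ∈ S) :
    ∃ b, MP R S v b ∧ R b v := by
  rcases h with rfl | ⟨a, b, h, hr⟩
  · simp at hv
  rcases h.split hv with rfl | ⟨S1, S2, u, k1, k2, k3, k4, k5⟩
  · exact ⟨b, h, hr⟩
  · refine ⟨u, (k2.append k1 k4.symm hr).congr ?_, k3⟩
    rw [Finset.union_comm, k5]

/-- Hamiltonian path, first one colour then the other. -/
lemma exists_RB {B : V → V → Prop} (hR : ∀ a b, R a b → R b a) (hB : ∀ a b, B a b → B b a)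
    (W : Finset V) (hW : W.Nonempty) (ht : ∀ a ∈ W, ∀ b ∈ W, R a b ∨ B a b) :
    ∃ S T v a b, S ∪ T = W ∧ S ∩ T = {v} ∧ MP R S v a ∧ MP B T v b := by
  induction hW using Finset.Nonempty.cons_induction with
  | singleton a => exact ⟨{a}, {a}, a, a, a, by simp, by simp, MP.single a, MP.single a⟩
  | cons x W hx hW ih =>
    obtain ⟨S, T, v, a, b, h1, h2, h3, h4⟩ := ih (fun a ha b hb => ht a (by simp [ha]) b (by simp [hb]))
    have hxS : x ∉ S := fun h => hx (h1 ▸ Finset.mem_union_left _ h)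
    have hxT : x ∉ T := fun h => hx (h1 ▸ Finset.mem_union_right _ h)
    have hvW : v ∈ W := h1 ▸ Finset.mem_union_left _ h3.left
    have key : ∀ y, y ∈ S → y ∈ T → y = v := by
      intro y hy hy'
      have : y ∈ S ∩ T := Finset.mem_inter.2 ⟨hy, hy'⟩
      rw [h2] at this; simpa using this
    rw [Finset.cons_eq_insert]
    rcases ht x (by simp) v (by simp [hvW]) with hxv | hxv
    · rcases h4.uncons with ⟨rfl, rfl⟩ | ⟨c, T', k1, rfl, k2, k3⟩
      · refine ⟨insert x S, {x}, x, a, x, ?_, ?_, MP.cons hxS hxv h3, MP.single x⟩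
        · rw [← h1]; have := h3.left; ext y; simp; grind
        · simp
      · have hcW : c ∈ W := h1 ▸ Finset.mem_union_right _ (by simp [k3.left])
        have hvS := h3.left
        have hcT := k3.left
        rcases ht x (by simp) c (by simp [hcW]) with hxc | hxc
        · refine ⟨insert c (insert x S), T', c, a, b, ?_, ?_,
            MP.cons ?_ (hR _ _ hxc) (MP.cons hxS hxv h3), k3⟩
          · rw [← h1]; ext y; simp; grind
          · ext y; simp; grind
          · simp; grind
        · refine ⟨insert x S, insert x T', x, a, b, ?_, ?_, MP.cons hxS hxv h3, MP.cons ?_ hxc k3⟩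
          · rw [← h1]; ext y; simp; grind
          · ext y; simp; grind
          · grind
    · rcases h3.uncons with ⟨rfl, rfl⟩ | ⟨c, S', k1, rfl, k2, k3⟩
      · refine ⟨{x}, insert x T, x, x, b, ?_, ?_, MP.single x, MP.cons hxT hxv h4⟩
        · rw [← h1]; have := h4.left; ext y; simp; grind
        · ext y; simp; tauto
      · have hcW : c ∈ W := h1 ▸ Finset.mem_union_left _ (by simp [k3.left])
        have hvS := h4.left
        have hcT := k3.left
        rcases ht x (by simp) c (by simp [hcW]) with hxc | hxc
        · refine ⟨insert x S', insert x T, x, a, b, ?_, ?_, MP.cons ?_ hxc k3, MP.cons hxT hxv h4⟩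
          · rw [← h1]; ext y; simp; grind
          · ext y; simp; grind
          · grind
        · refine ⟨S', insert c (insert x T), c, a, b, ?_, ?_, k3,
            MP.cons ?_ (hB _ _ hxc) (MP.cons hxT hxv h4)⟩
          · rw [← h1]; ext y; simp; grind
          · ext y; simp; grind
          · simp; grind

/-- snakes -/
inductive SN (B : V → V → Prop) (F L : V → Prop) : Finset V → V → Prop
  | last (a : V) : L a → SN B F L {a} a
  | step {a b : V} {S : Finset V} : a ∉ S → (B a b ∨ (L a ∧ F b)) → SN B F L S b →
      SN B F L (insert a S) a

lemma SN.left {B : V → V → Prop} {F L : V → Prop} {S : Finset V} {a : V} (h : SN B F L S a) :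
    a ∈ S := by
  cases h <;> simp

lemma SN.append {B : V → V → Prop} {F L : V → Prop} {S T : Finset V} {a b : V}
    (h : SN B F L S a) (h' : SN B F L T b) (hd : Disjoint S T) (hb : F b) :
    SN B F L (S ∪ T) a := by
  induction h with
  | last a ha =>
    rw [← Finset.insert_eq]
    exact SN.step (by simpa using hd) (Or.inr ⟨ha, hb⟩) h'
  | step h1 h2 h3 ih =>
    rw [Finset.disjoint_insert_left] at hd
    rw [Finset.insert_union]
    refine SN.step ?_ h2 (ih hd.2)
    simp [h1, hd.1]

lemma SN.snake {B : V → V → Prop} {F L : V → Prop}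
    (hF : ∀ a b, F a → F b → B a b) (hL : ∀ a b, L a → L b → B a b)
    (hB : ∀ a b, B a b → B b a)
    {S : Finset V} {a : V} (h : SN B F L S a) :
    (∃ z, (F z ∨ L z) ∧ MP B S a z) ∧
    (∀ P p, MP B P a p → P ∩ S = {a} → F p →
      ∃ y z, L y ∧ (F z ∨ L z) ∧ MP B (P ∪ S) y z) := by
  induction h with
  | last a ha =>
    refine ⟨⟨a, Or.inr ha, MP.single a⟩, fun P p hP hi hp => ⟨a, p, ha, Or.inl hp, hP.congr ?_⟩⟩
    have := hP.left
    ext y; simp; grind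
  | @step a b S h1 h2 h3 ih =>
    obtain ⟨⟨z, hz, hm⟩, ih2⟩ := ih
    have hb := h3.left
    constructor
    · rcases h2 with h2 | ⟨ha, hFb⟩
      · exact ⟨z, hz, MP.cons h1 h2 hm⟩
      · obtain ⟨y, z', hy, hz', hm'⟩ := ih2 {b} b (MP.single b) (by simp [hb]) hFb
        have e : {b} ∪ S = S := by ext y; simp; grind
        rw [e] at hm'
        exact ⟨z', hz', MP.cons h1 (hL _ _ ha hy) hm'⟩
    · intro P p hP hi hp
      have haP := hP.left
      have key : ∀ y ∈ P, y ∈ insert a S → y = a := by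
        intro y hy hy'
        have : y ∈ P ∩ insert a S := Finset.mem_inter.2 ⟨hy, hy'⟩
        rw [hi] at this; simpa using this
      have hbP : b ∉ P := by
        intro hbP
        have := key b hbP (by simp [hb])
        subst this; exact h1 hb
      rcases h2 with h2 | ⟨ha, hFb⟩
      · obtain ⟨y, z', hy, hz', hm'⟩ := ih2 (insert b P) p (MP.cons hbP (hB _ _ h2) hP) (by
          ext y; simp; grind) hp
        refine ⟨y, z', hy, hz', hm'.congr ?_⟩
        ext y; simp; grind
      · refine ⟨a, z, ha, hz, (hP.append hm ?_ (hF _ _ hp hFb)).congr ?_⟩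
        · rw [Finset.disjoint_left]; grind
        · ext y; simp; grind

end basic
end BT

namespace BT
set_option linter.unusedSectionVars false
set_option linter.unusedVariables false
section cfg
variable {V : Type*} [DecidableEq V] [Fintype V] {R B : V → V → Prop}

def Done (R B : V → V → Prop) : Prop :=
  ∃ S T : Finset V, Disjoint S T ∧ S ∪ T = Finset.univ ∧ Cyc R S ∧ Cyc B T

structure Ctx (R B : V → V → Prop) (k : ℕ) : Prop where
  Rs : ∀ a b, R a b → R b a
  Bs : ∀ a b, B a b → B b a
  Rr : ∀ a, R a a
  Br : ∀ a, B a a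
  tot : ∀ a b, R a b ∨ B a b
  ex : ∀ a b, R a b → B a b → a = b
  nd : ¬ Done R B
  mx : ∀ S T a b, Cyc R S → MP B T a b → Disjoint S T → S ∪ T = Finset.univ → S.card ≤ k

structure Cfg (R B : V → V → Prop) (k : ℕ) (r : ℤ → V) (Q : Finset V) (p q : V) : Prop where
  pos : 0 < k
  per : ∀ i j, r i = r j ↔ (k : ℤ) ∣ i - j
  red : ∀ i, R (r i) (r (i + 1))
  path : MP B Q p q
  mem : ∀ v, v ∈ Q ↔ ∀ i, r i ≠ v

/-- step arcs -/
def arc (r : ℤ → V) (s i : ℤ) (n : ℕ) : Finset V :=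
  (Finset.range (n + 1)).image (fun j : ℕ => r (i + s * j))

lemma mem_arc {r : ℤ → V} {s i : ℤ} {n : ℕ} {v : V} :
    v ∈ arc r s i n ↔ ∃ j : ℕ, j ≤ n ∧ r (i + s * j) = v := by
  simp [arc]

lemma arc_zero (r : ℤ → V) (s i : ℤ) : arc r s i 0 = {r i} := by
  simp [arc]

lemma arc_succ (r : ℤ → V) (s i : ℤ) (n : ℕ) :
    arc r s i (n + 1) = insert (r i) (arc r s (i + s) n) := by
  ext v
  simp only [mem_arc, Finset.mem_insert]
  constructor
  · rintro ⟨j, hj, rfl⟩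
    rcases j with _ | j
    · left; simp
    · right; exact ⟨j, by omega, by push_cast; congr 1; ring⟩
  · rintro (rfl | ⟨j, hj, rfl⟩)
    · exact ⟨0, by omega, by simp⟩
    · exact ⟨j + 1, by omega, by push_cast; congr 1; ring⟩

lemma arc_succ' (r : ℤ → V) (s i : ℤ) (n : ℕ) :
    arc r s i (n + 1) = insert (r (i + s * (n + 1))) (arc r s i n) := by
  ext v
  simp only [mem_arc, Finset.mem_insert]
  constructor
  · rintro ⟨j, hj, rfl⟩
    by_cases h : j = n + 1
    · left; subst h; push_cast; rfl
    · right; exact ⟨j, by omega, rfl⟩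
  · rintro (rfl | ⟨j, hj, rfl⟩)
    · exact ⟨n + 1, by omega, by push_cast; rfl⟩
    · exact ⟨j, by omega, rfl⟩

/-- chains along arcs -/
lemma arc_MP {r : ℤ → V} {C : V → V → Prop} {s : ℤ} (n : ℕ) (i : ℤ)
    (hC : ∀ j : ℕ, j < n → C (r (i + s * j)) (r (i + s * j + s)))
    (hinj : ∀ j : ℕ, 0 < j → j ≤ n → ∀ l, r l ≠ r (l + s * j)) :
    MP C (arc r s i n) (r i) (r (i + s * n)) := by
  induction n generalizing i with
  | zero => simpa [arc_zero] using MP.single (r i)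
  | succ n ih =>
    rw [arc_succ]
    have h1 := ih (i + s) (fun j hj => by
      have := hC (j + 1) (by omega)
      push_cast at this
      convert this using 2 <;> ring) (fun j h1 h2 => hinj j h1 (by omega))
    have e : i + s + s * (n : ℤ) = i + s * ((n + 1 : ℕ) : ℤ) := by push_cast; ring
    rw [e] at h1
    refine MP.cons ?_ (by simpa using hC 0 (by omega)) h1
    rw [mem_arc]
    rintro ⟨j, hj, he⟩
    refine hinj (j + 1) (by omega) (by omega) i ?_
    rw [← he]; push_cast; congr 1; ring

lemma arc_SN {r : ℤ → V} {C : V → V → Prop} {F L : V → Prop} {s : ℤ} (n : ℕ) (i : ℤ)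
    (hC : ∀ i, C (r i) (r (i + s)) ∨ (L (r i) ∧ F (r (i + s))))
    (hinj : ∀ j : ℕ, 0 < j → j ≤ n → ∀ l, r l ≠ r (l + s * j)) (hL : L (r (i + s * n))) :
    SN C F L (arc r s i n) (r i) := by
  induction n generalizing i with
  | zero => simpa [arc_zero] using SN.last (r i) (by simpa using hL)
  | succ n ih =>
    rw [arc_succ]
    have h1 := ih (i + s) (fun j h1 h2 => hinj j h1 (by omega)) (by
      convert hL using 2; push_cast; ring)
    refine SN.step ?_ (hC i) h1
    rw [mem_arc]
    rintro ⟨j, hj, he⟩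
    refine hinj (j + 1) (by omega) (by omega) i ?_
    rw [← he]; push_cast; congr 1; ring

variable {k : ℕ} {r : ℤ → V} {Q : Finset V} {p q : V}

namespace Cfg

lemma shift (h : Cfg R B k r Q p q) (s : ℤ) : Cfg R B k (fun i => r (i + s)) Q p q where
  pos := h.pos
  per i j := by rw [h.per]; congr! 1; ring
  red i := by
    have := h.red (i + s)
    convert this using 2; ring
  path := h.path
  mem v := by
    rw [h.mem]
    exact ⟨fun H i => H _, fun H i => by simpa using H (i - s)⟩

lemma rev (c : Ctx R B k) (h : Cfg R B k r Q p q) : Cfg R B k (fun i => r (-i)) Q p q where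
  pos := h.pos
  per i j := by
    rw [h.per, ← dvd_neg]; congr! 1; ring
  red i := by
    have := c.Rs _ _ (h.red (-(i + 1)))
    convert this using 2; ring
  path := h.path
  mem v := by
    rw [h.mem]
    exact ⟨fun H i => H _, fun H i => by simpa using H (-i)⟩

lemma revQ (c : Ctx R B k) (h : Cfg R B k r Q p q) : Cfg R B k r Q q p where
  pos := h.pos
  per := h.per
  red := h.red
  path := h.path.reverse c.Bs
  mem := h.mem

lemma add_k (h : Cfg R B k r Q p q) (i : ℤ) : r (i + k) = r i := by
  rw [h.per]; simp

lemma ne_of_lt (h : Cfg R B k r Q p q) {i j : ℤ} (h1 : i < j) (h2 : j < i + k) : r i ≠ r j := by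
  rw [Ne, h.per]
  intro hd
  have := Int.eq_zero_of_abs_lt_dvd hd (by rw [abs_lt]; constructor <;> omega)
  omega

lemma notQ (h : Cfg R B k r Q p q) (i : ℤ) : r i ∉ Q := by
  rw [h.mem]; push Not; exact ⟨i, rfl⟩

/-- full arc -/
lemma full (h : Cfg R B k r Q p q) (i : ℤ) : arc r 1 i (k - 1) = Qᶜ := by
  have hk := h.pos
  ext v
  rw [mem_arc, Finset.mem_compl, h.mem]
  push Not
  constructor
  · rintro ⟨j, _, hj⟩; exact ⟨_, hj⟩
  · rintro ⟨l, rfl⟩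
    have h1 := Int.emod_nonneg (l - i) (b := (k : ℤ)) (by omega)
    have h2 := Int.emod_lt_of_pos (l - i) (b := (k : ℤ)) (by omega)
    refine ⟨((l - i) % k).toNat, by omega, ?_⟩
    rw [h.per, Int.toNat_of_nonneg h1]
    have := Int.emod_add_mul_ediv (l - i) k
    exact ⟨-((l - i) / k), by linarith⟩

lemma arcR (h : Cfg R B k r Q p q) (i : ℤ) (n : ℕ) (hn : n < k) :
    MP R (arc r 1 i n) (r i) (r (i + n)) := by
  have := arc_MP (r := r) (C := R) (s := 1) n i (fun j _ => h.red _)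
    (fun j h1 h2 l => h.ne_of_lt (by omega) (by omega))
  simpa using this

/-- removing last from an arc -/
lemma arc_erase (h : Cfg R B k r Q p q) (i : ℤ) (n : ℕ) (hn : n + 1 < k) :
    arc r 1 i n = (arc r 1 i (n + 1)).erase (r (i + (n + 1))) := by
  rw [arc_succ', one_mul, Finset.erase_insert]
  rw [mem_arc]
  rintro ⟨j, hj, he⟩
  exact h.ne_of_lt (i := i + 1 * j) (j := i + (n + 1)) (by omega) (by omega) he

lemma arc1 (h : Cfg R B k r Q p q) (i : ℤ) (hk : 2 ≤ k) :
    MP R (Qᶜ.erase (r i)) (r (i + 1)) (r (i - 1)) := by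
  have h1 := h.arcR (i + 1) (k - 2) (by omega)
  have e := h.arc_erase (i + 1) (k - 2) (by omega)
  rw [show k - 2 + 1 = k - 1 by omega, h.full] at e
  have e1 : r (i + 1 + (((k - 2 : ℕ) : ℤ) + 1)) = r i := by
    rw [← h.add_k i]; congr 1; omega
  have e2 : r (i + 1 + ((k - 2 : ℕ) : ℤ)) = r (i - 1) := by
    rw [← h.add_k (i - 1)]; congr 1; omega
  rw [e1] at e
  rw [e, e2] at h1
  exact h1

lemma arc2 (h : Cfg R B k r Q p q) (i : ℤ) (hk : 3 ≤ k) :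
    MP R ((Qᶜ.erase (r i)).erase (r (i + 1))) (r (i + 2)) (r (i - 1)) := by
  have h1 := h.arcR (i + 2) (k - 3) (by omega)
  have e := h.arc_erase (i + 2) (k - 3) (by omega)
  have e' := h.arc_erase (i + 2) (k - 2) (by omega)
  rw [show k - 2 + 1 = k - 1 by omega, h.full] at e'
  rw [show k - 3 + 1 = k - 2 by omega, e'] at e
  have e1 : r (i + 2 + (((k - 2 : ℕ) : ℤ) + 1)) = r (i + 1) := by
    rw [← h.add_k (i + 1)]; congr 1; omega
  have e2 : r (i + 2 + ((k - 3 : ℕ) : ℤ)) = r (i - 1) := by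
    rw [← h.add_k (i - 1)]; congr 1; omega
  have e3 : r (i + 2 + (((k - 3 : ℕ) : ℤ) + 1)) = r i := by
    rw [← h.add_k i]; congr 1; omega
  rw [e1, e3] at e
  rw [e, e2] at h1
  rw [Finset.erase_right_comm]
  exact h1

lemma arc3 (h : Cfg R B k r Q p q) (i : ℤ) (hk : 4 ≤ k) :
    MP R (((Qᶜ.erase (r i)).erase (r (i + 1))).erase (r (i + 2))) (r (i + 3)) (r (i - 1)) := by
  have h2 := h.arc2 (i + 1) (by omega)
  rw [show i + 1 + 1 = i + 2 by ring, show i + 1 + 2 = i + 3 by ring,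
    show i + 1 - 1 = i by ring] at h2
  have h2' := h2
  have h1 := h.arcR (i + 3) (k - 4) (by omega)
  have e := h.arc_erase (i + 3) (k - 4) (by omega)
  have e' := h.arc_erase (i + 3) (k - 3) (by omega)
  have e'' := h.arc_erase (i + 3) (k - 2) (by omega)
  rw [show k - 2 + 1 = k - 1 by omega, h.full] at e''
  rw [show k - 3 + 1 = k - 2 by omega, e''] at e'
  rw [show k - 4 + 1 = k - 3 by omega, e'] at e
  have e1 : r (i + 3 + (((k - 2 : ℕ) : ℤ) + 1)) = r (i + 2) := by
    rw [← h.add_k (i + 2)]; congr 1; omega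
  have e2 : r (i + 3 + ((k - 4 : ℕ) : ℤ)) = r (i - 1) := by
    rw [← h.add_k (i - 1)]; congr 1; omega
  have e3 : r (i + 3 + (((k - 3 : ℕ) : ℤ) + 1)) = r (i + 1) := by
    rw [← h.add_k (i + 1)]; congr 1; omega
  have e4 : r (i + 3 + (((k - 4 : ℕ) : ℤ) + 1)) = r i := by
    rw [← h.add_k i]; congr 1; omega
  rw [e1, e3, e4] at e
  rw [e, e2] at h1
  refine h1.congr ?_
  ext x; simp; tauto

lemma arc0 (h : Cfg R B k r Q p q) (i : ℤ) : MP R Qᶜ (r i) (r (i - 1)) := by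
  have hk := h.pos
  have h1 := h.arcR i (k - 1) (by omega)
  have e2 : r (i + ((k - 1 : ℕ) : ℤ)) = r (i - 1) := by
    rw [← h.add_k (i - 1)]; congr 1; omega
  rwa [h.full, e2] at h1

lemma card (h : Cfg R B k r Q p q) : Qᶜ.card = k := by
  have hk := h.pos
  rw [← h.full 0, arc, Finset.card_image_of_injOn, Finset.card_range]
  · omega
  · intro a ha b hb hab
    simp only [Finset.coe_range, Set.mem_Iio] at ha hb
    simp only at hab
    by_contra hne
    rcases lt_or_gt_of_ne hne with hl | hl
    · exact h.ne_of_lt (by omega) (by omega) hab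
    · exact h.ne_of_lt (by omega) (by omega) hab.symm

/-- replacing one vertex -/
lemma replace (c : Ctx R B k) (h : Cfg R B k r Q p q) (hk : 2 ≤ k) (i : ℤ) {x : V} (hx : x ∈ Q)
    (h1 : R (r (i - 1)) x) (h2 : R x (r (i + 1))) {Q' : Finset V} {p' q' : V}
    (hQ : MP B Q' p' q') (hQ' : Q' = insert (r i) (Q.erase x)) :
    Cfg R B k (fun j => if (k : ℤ) ∣ j - i then x else r j) Q' p' q' where
  pos := h.pos
  per a b := by
    have hxr : ∀ j, r j ≠ x := (h.mem x).1 hx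
    by_cases ha : (k : ℤ) ∣ a - i <;> by_cases hb : (k : ℤ) ∣ b - i
    · simp only [ha, hb, if_true, true_iff]
      have := dvd_sub ha hb
      simpa using this
    · simp only [ha, hb, if_true, if_false]
      refine ⟨fun e => absurd e.symm (hxr b), fun e => absurd ?_ hb⟩
      have := dvd_sub ha e
      simpa using this
    · simp only [ha, hb, if_true, if_false]
      refine ⟨fun e => absurd e (hxr a), fun e => absurd ?_ ha⟩
      have := dvd_add e hb
      simpa using this
    · simp only [ha, hb, if_false, h.per]
  red a := by
    by_cases ha : (k : ℤ) ∣ a - i <;> by_cases hb : (k : ℤ) ∣ a + 1 - i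
    · exfalso
      have h3 := dvd_sub hb ha
      rw [show a + 1 - i - (a - i) = 1 by ring] at h3
      have := Int.le_of_dvd (by norm_num) h3
      omega
    · simp only [ha, hb, if_true, if_false]
      have : r (a + 1) = r (i + 1) := by
        rw [h.per]; convert ha using 1; ring
      rwa [this]
    · simp only [ha, hb, if_true, if_false]
      have : r a = r (i - 1) := by
        rw [h.per]; convert hb using 1; ring
      rwa [this]
    · simp only [ha, hb, if_false]; exact h.red a
  path := hQ
  mem v := by
    have hxr : ∀ j, r j ≠ x := (h.mem x).1 hx
    rw [hQ', Finset.mem_insert, Finset.mem_erase, h.mem]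
    constructor
    · rintro (rfl | ⟨hne, hv⟩) j
      · by_cases hj : (k : ℤ) ∣ j - i
        · simp only [hj, if_true]; exact (hxr i).symm
        · simp only [hj, if_false]; rw [Ne, h.per]; exact hj
      · by_cases hj : (k : ℤ) ∣ j - i
        · simp only [hj, if_true]; exact hne.symm
        · simp only [hj, if_false]; exact hv j
    · intro H
      by_cases hv : v = r i
      · exact Or.inl hv
      right
      refine ⟨?_, ?_⟩
      · have := H i
        simp only [sub_self, dvd_zero, if_true] at this
        exact this.symm
      · intro j
        by_cases hj : (k : ℤ) ∣ j - i
        · have := (h.per j i).2 hj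
          rw [this]; exact fun e => hv e.symm
        · have := H j
          simpa only [hj, if_false] using this

end Cfg
end cfg
end BT

namespace BT
set_option linter.unusedSectionVars false
set_option linter.unusedVariables false
section bt
variable {V : Type*} [DecidableEq V] [Fintype V] {R B : V → V → Prop}
variable {k : ℕ} {r : ℤ → V} {Q : Finset V} {p q : V}

lemma Ctx.bad (c : Ctx R B k) {T : Finset V} (hT : Cyc B T) (hS : Cyc R Tᶜ) : False :=
  c.nd ⟨Tᶜ, T, disjoint_compl_left, by rw [Finset.union_comm]; exact Finset.union_compl T, hS, hT⟩

lemma Ctx.badB (c : Ctx R B k) {T : Finset V} (hT : Cyc B T) (hS : T = Finset.univ) : False :=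
  c.bad hT (by subst hS; simp [Cyc])

lemma Ctx.big (c : Ctx R B k) {S : Finset V} (hS : Cyc R S) {a b : V} (hT : MP B Sᶜ a b)
    (hc : k < S.card) : False := by
  have := c.mx _ _ _ _ hS hT disjoint_compl_right (Finset.union_compl S)
  omega

lemma Ctx.nB (c : Ctx R B k) {a b : V} (h : ¬ B a b) : R a b := (c.tot a b).resolve_right h
lemma Ctx.nR (c : Ctx R B k) {a b : V} (h : ¬ R a b) : B a b := (c.tot a b).resolve_left h

namespace Cfg

lemma closeR (h : Cfg R B k r Q p q) : Cyc R Qᶜ :=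
  (h.arc0 0).cyc (by simpa using h.red (0 - 1))

lemma L1 (c : Ctx R B k) (h : Cfg R B k r Q p q) : ¬ B p q := fun hb =>
  c.bad (h.path.cyc (c.Bs _ _ hb)) h.closeR

lemma pne (c : Ctx R B k) (h : Cfg R B k r Q p q) : p ≠ q := by
  rintro rfl; exact h.L1 c (c.Br _)

lemma dec (c : Ctx R B k) (h : Cfg R B k r Q p q) :
    ∃ q2 q3 Q3, q2 ∉ Q3 ∧ p ∉ Q3 ∧ p ≠ q2 ∧ Q = insert p (insert q2 Q3) ∧ B p q2 ∧ B q2 q3 ∧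
      MP B Q3 q3 q ∧ MP B (insert q2 Q3) q2 q := by
  obtain ⟨q2, Q2, h1, h2, h3, h4⟩ := h.path.unconsNe (h.pne c)
  have : q2 ≠ q := by rintro rfl; exact h.L1 c h3
  obtain ⟨q3, Q3, h5, h6, h7, h8⟩ := h4.unconsNe this
  subst h6
  refine ⟨q2, q3, Q3, h5, ?_, ?_, h2, h3, h7, h8, h4⟩
  · intro hh; exact h1 (by simp [hh])
  · rintro rfl; exact h1 (by simp)

lemma rest_p (c : Ctx R B k) (h : Cfg R B k r Q p q) : ∃ x, MP B (Q.erase p) x q := by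
  obtain ⟨q2, q3, Q3, h1, h2, h3, h4, h5, h6, h7, h8⟩ := h.dec c
  refine ⟨q2, h8.congr ?_⟩
  rw [h4, Finset.erase_insert]; simp [h2, h3]

lemma rest_q (c : Ctx R B k) (h : Cfg R B k r Q p q) : ∃ x, MP B (Q.erase q) x p :=
  (h.revQ c).rest_p c

lemma rest_pq (c : Ctx R B k) (h : Cfg R B k r Q p q) :
    ∃ x y, MP B ((Q.erase p).erase q) x y := by
  obtain ⟨q2, q3, Q3, h1, h2, h3, h4, h5, h6, h7, h8⟩ := h.dec c
  have hne : q ≠ q2 := by rintro rfl; exact h.L1 c h5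
  obtain ⟨y, T, h9, h10, h11, h12⟩ := (h8.reverse c.Bs).unconsNe hne
  refine ⟨y, q2, h12.congr ?_⟩
  rw [h4, Finset.erase_insert (by simp [h2, h3]), h10, Finset.erase_insert h9]

end Cfg

def NN (B : V → V → Prop) (r : ℤ → V) (p q : V) (i : ℤ) : Prop := B (r i) p ∧ B (r i) q

namespace Cfg

lemma conn (c : Ctx R B k) (h : Cfg R B k r Q p q) {i j : ℤ} (hi : ¬ NN B r p q i)
    (hj : ¬ NN B r p q j) : ∃ T a b, T ⊆ Q ∧ MP R T a b ∧ R (r i) a ∧ R b (r j) ∧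
      ∃ x y, MP B (Q \ T) x y := by
  have hp := h.path.left
  have hq := h.path.right
  have hpq := h.pne c
  have hR := c.nB (h.L1 c)
  obtain ⟨x1, m1⟩ := h.rest_p c
  obtain ⟨x2, m2⟩ := h.rest_q c
  obtain ⟨x3, y3, m3⟩ := h.rest_pq c
  have hi' : R (r i) p ∨ R (r i) q := by
    by_contra hh; push Not at hh; exact hi ⟨c.nR hh.1, c.nR hh.2⟩
  have hj' : R (r j) p ∨ R (r j) q := by
    by_contra hh; push Not at hh; exact hj ⟨c.nR hh.1, c.nR hh.2⟩
  rcases hi' with hi' | hi' <;> rcases hj' with hj' | hj'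
  · exact ⟨{p}, p, p, by simpa using hp, MP.single p, hi', c.Rs _ _ hj', _, _, m1.congr (by ext; simp; tauto)⟩
  · exact ⟨{p, q}, p, q, by intro; simp; grind, MP.cons (by simpa using hpq) hR (MP.single q), hi', c.Rs _ _ hj', _, _, m3.congr (by ext; simp; tauto)⟩
  · exact ⟨{q, p}, q, p, by intro; simp; grind, MP.cons (by simpa using hpq.symm) (c.Rs _ _ hR) (MP.single p), hi', c.Rs _ _ hj', _, _, m3.congr (by ext; simp; tauto)⟩
  · exact ⟨{q}, q, q, by simpa using hq, MP.single q, hi', c.Rs _ _ hj', _, _, m2.congr (by ext; simp; tauto)⟩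

lemma no_conn (c : Ctx R B k) (h : Cfg R B k r Q p q) {i j : ℤ} (hi : ¬ NN B r p q i)
    (hj : ¬ NN B r p q j) (hm : MP R Qᶜ (r j) (r i)) : False := by
  obtain ⟨T, a, b, h1, h2, h3, h4, x, y, h5⟩ := h.conn c hi hj
  have hd : Disjoint Qᶜ T := by
    rw [Finset.disjoint_left]; intro x hx hx'; exact (Finset.mem_compl.1 hx) (h1 hx')
  refine c.big ((hm.append h2 hd h3).cyc h4) (h5.congr ?_) ?_
  · ext; simp
  · rw [Finset.card_union_of_disjoint hd, h.card]
    have : 0 < T.card := Finset.card_pos.2 ⟨_, h2.left⟩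
    omega

lemma L2 (c : Ctx R B k) (h : Cfg R B k r Q p q) {i : ℤ} (hi : ¬ NN B r p q i) :
    NN B r p q (i + 1) := by
  by_contra hj
  refine h.no_conn c hi hj ?_
  have := h.arc0 (i + 1)
  simpa using this

lemma L2' (c : Ctx R B k) (h : Cfg R B k r Q p q) {i : ℤ} (hi : ¬ NN B r p q i) :
    NN B r p q (i - 1) := by
  by_contra hj
  have := h.L2 c hj
  simp at this
  exact hi this

lemma nn_k (h : Cfg R B k r Q p q) (i : ℤ) : NN B r p q (i + k) ↔ NN B r p q i := by
  simp only [NN, h.add_k]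

lemma nn_congr {r : ℤ → V} {i j : ℤ} (h : r i = r j) : NN B r p q i ↔ NN B r p q j := by
  simp only [NN, h]

/-- Q plus an N vertex is a blue cycle -/
lemma addN (c : Ctx R B k) (h : Cfg R B k r Q p q) {i : ℤ} (hi : NN B r p q i) :
    Cyc B (insert (r i) Q) :=
  (MP.cons (h.notQ i) hi.1 h.path).cyc (c.Bs _ _ hi.2)

lemma two_le (c : Ctx R B k) (h : Cfg R B k r Q p q) : 2 ≤ k := by
  by_contra hk
  have hk1 : k = 1 := by have := h.pos; omega
  have e : r (0 + 1) = r 0 := by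
    have := h.add_k 0; rw [hk1] at this; simpa using this
  have h0 : NN B r p q 0 := by
    by_contra h0
    have := h.L2 c h0
    rw [nn_congr e] at this; exact h0 this
  refine c.badB (h.addN c h0) ?_
  have := h.full 0
  rw [hk1, Nat.sub_self, arc_zero] at this
  rw [Finset.insert_eq, this, Finset.union_comm, Finset.union_compl]

lemma L3 (c : Ctx R B k) (h : Cfg R B k r Q p q) {i : ℤ} (hi : NN B r p q i) :
    ¬ R (r (i - 1)) (r (i + 1)) := by
  intro hr
  refine c.bad (h.addN c hi) (((h.arc1 i (h.two_le c)).cyc hr).congr ?_)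
  ext; simp

lemma L3' (c : Ctx R B k) (h : Cfg R B k r Q p q) {i : ℤ} (hi : NN B r p q i) :
    B (r (i - 1)) (r (i + 1)) := c.nR (h.L3 c hi)

lemma exN (c : Ctx R B k) (h : Cfg R B k r Q p q) : ∃ i, NN B r p q i := by
  by_contra hh; push Not at hh; exact hh _ (h.L2 c (hh 0))

lemma four_le (c : Ctx R B k) (h : Cfg R B k r Q p q) : 4 ≤ k := by
  have h2 := h.two_le c
  obtain ⟨i, hi⟩ := h.exN c
  have h3 := h.L3 c hi
  by_contra hk
  have : k = 2 ∨ k = 3 := by omega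
  rcases this with rfl | rfl
  · apply h3
    have := h.add_k (i - 1)
    rw [← this, show i - 1 + ((2 : ℕ) : ℤ) = i + 1 by push_cast; ring]
    exact c.Rr _
  · apply h3
    have := h.add_k (i - 1)
    rw [← this, show i - 1 + ((3 : ℕ) : ℤ) = i + 1 + 1 by push_cast; ring]
    exact c.Rs _ _ (h.red _)

lemma L4 (c : Ctx R B k) (h : Cfg R B k r Q p q) {i j : ℤ} (hi : ¬ NN B r p q i)
    (hj : ¬ NN B r p q j) : B (r (i + 1)) (r (j + 1)) := by
  have hk := h.pos
  by_contra hB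
  have hR := c.nB hB
  wlog hlt : i < j ∧ j < i + k generalizing j
  · have h1 := Int.emod_nonneg (j - i) (b := (k : ℤ)) (by omega)
    have h2 := Int.emod_lt_of_pos (j - i) (b := (k : ℤ)) (by omega)
    have h3 := Int.emod_add_mul_ediv (j - i) k
    have e : ∀ s, r (i + (j - i) % k + s) = r (j + s) := by
      intro s
      rw [h.per]; exact ⟨-((j - i) / k), by linarith⟩
    have hne : (j - i) % k ≠ 0 := by
      intro h0
      have := e 1
      rw [h0, add_zero] at this
      rw [this] at hB; exact hB (c.Br _)
    refine this (j := i + (j - i) % k) ?_ ?_ ?_ ⟨by omega, by omega⟩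
    · have := e 0
      simp only [add_zero] at this
      rwa [nn_congr this]
    · rwa [e]
    · rwa [e]
  obtain ⟨hl1, hl2⟩ := hlt
  obtain ⟨n, hn⟩ : ∃ n : ℕ, j = i + 1 + n := ⟨(j - i - 1).toNat, by omega⟩
  obtain ⟨m, hm⟩ : ∃ m : ℕ, i + k = j + 1 + m := ⟨(i + k - j - 1).toNat, by omega⟩
  have a1 := h.arcR (i + 1) n (by omega)
  have a2 := h.arcR (j + 1) m (by omega)
  rw [← hn] at a1
  rw [← hm, h.add_k] at a2
  refine h.no_conn c hi hj (((a1.reverse c.Rs).append a2 ?_ hR).congr ?_)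
  · rw [Finset.disjoint_left]
    intro x hx hx'
    rw [mem_arc] at hx hx'
    obtain ⟨u, hu, rfl⟩ := hx
    obtain ⟨w, hw, e⟩ := hx'
    exact h.ne_of_lt (by omega) (by omega) e.symm
  · rw [← h.full (i + 1)]
    ext x
    rw [Finset.mem_union, mem_arc, mem_arc, mem_arc]
    constructor
    · rintro (⟨u, hu, rfl⟩ | ⟨u, hu, rfl⟩)
      · exact ⟨u, by omega, rfl⟩
      · exact ⟨u + n + 1, by omega, by congr 1; push_cast; omega⟩
    · rintro ⟨u, hu, rfl⟩
      by_cases hun : u ≤ n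
      · exact Or.inl ⟨u, hun, rfl⟩
      · refine Or.inr ⟨u - (n + 1), by omega, by congr 1; omega⟩

lemma L4' (c : Ctx R B k) (h : Cfg R B k r Q p q) {i j : ℤ} (hi : ¬ NN B r p q i)
    (hj : ¬ NN B r p q j) : B (r (i - 1)) (r (j - 1)) := by
  have := (h.rev c).L4 c (i := -i) (j := -j) (by simpa [NN] using hi) (by simpa [NN] using hj)
  convert this using 2 <;> ring

end Cfg
end bt
end BT

namespace BT
set_option linter.unusedSectionVars false
set_option linter.unusedVariables false
section bt
variable {V : Type*} [DecidableEq V] [Fintype V] {R B : V → V → Prop}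
variable {k : ℕ} {r : ℤ → V} {Q : Finset V} {p q : V}

def FF (B : V → V → Prop) (r : ℤ → V) (p q : V) (x : V) : Prop :=
  ∃ j, ¬ NN B r p q j ∧ x = r (j + 1)
def LL (B : V → V → Prop) (r : ℤ → V) (p q : V) (x : V) : Prop :=
  ∃ j, ¬ NN B r p q j ∧ x = r (j - 1)

namespace Cfg

lemma FL (c : Ctx R B k) (h : Cfg R B k r Q p q) {x : V}
    (hx : FF B r p q x ∨ LL B r p q x) : B x p ∧ B x q := by
  rcases hx with ⟨j, hj, rfl⟩ | ⟨j, hj, rfl⟩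
  · exact h.L2 c hj
  · exact h.L2' c hj

lemma step2 (c : Ctx R B k) (h : Cfg R B k r Q p q) (i : ℤ) :
    B (r i) (r (i + 2)) ∨ (LL B r p q (r i) ∧ FF B r p q (r (i + 2))) := by
  by_cases hN : NN B r p q (i + 1)
  · left
    have := h.L3' c hN
    convert this using 2 <;> ring
  · right
    exact ⟨⟨i + 1, hN, by congr 1; ring⟩, ⟨i + 1, hN, by congr 1; ring⟩⟩

lemma snake (c : Ctx R B k) (h : Cfg R B k r Q p q) {S : Finset V} {a : V}
    (hs : SN B (FF B r p q) (LL B r p q) S a) :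
    ∃ z, (B z p ∧ B z q) ∧ MP B S a z := by
  obtain ⟨⟨z, hz, hm⟩, -⟩ := hs.snake (by
    rintro a b ⟨i, hi, rfl⟩ ⟨j, hj, rfl⟩; exact h.L4 c hi hj) (by
    rintro a b ⟨i, hi, rfl⟩ ⟨j, hj, rfl⟩; exact h.L4' c hi hj) c.Bs
  exact ⟨z, h.FL c hz, hm⟩

lemma close (c : Ctx R B k) (h : Cfg R B k r Q p q) {P : Finset V} {x y : V} (hP : MP B P x y)
    (hx : B x p ∧ B x q) (hy : B y p ∧ B y q) (hd : Disjoint P Q) : Cyc B (P ∪ Q) :=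
  (hP.append h.path hd hy.1).cyc (c.Bs _ _ hx.2)

lemma ham (c : Ctx R B k) (h : Cfg R B k r Q p q) {P : Finset V} {x y : V} (hP : MP B P x y)
    (hx : B x p ∧ B x q) (hy : B y p ∧ B y q) (he : P = Qᶜ) : False := by
  subst he
  refine c.badB (h.close c hP hx hy disjoint_compl_left) ?_
  rw [Finset.union_comm, Finset.union_compl]

lemma even (c : Ctx R B k) (h : Cfg R B k r Q p q) : Even k := by
  by_contra hk
  rw [Nat.not_even_iff_odd] at hk
  obtain ⟨a, ha⟩ := hk
  have hpos := h.pos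
  have hinj : ∀ j : ℕ, 0 < j → j ≤ k - 1 → ∀ l, r l ≠ r (l + 2 * j) := by
    intro j h1 h2 l e
    rw [h.per] at e
    obtain ⟨t, ht⟩ := e
    have hd : (k : ℤ) ∣ j := by
      refine ⟨-t * (a + 1) - j * 1, ?_⟩
      have hka : (k : ℤ) = 2 * a + 1 := by exact_mod_cast ha
      rw [hka] at ht ⊢
      linear_combination (-1 : ℤ) * (a + 1) * ht
    have := Int.le_of_dvd (by omega) hd
    omega
  have hset : ∀ i, arc r 2 i (k - 1) = Qᶜ := by
    intro i
    ext v
    rw [mem_arc, Finset.mem_compl, h.mem]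
    push Not
    constructor
    · rintro ⟨j, _, hj⟩; exact ⟨_, hj⟩
    · rintro ⟨l, rfl⟩
      set w := (l - i) * (a + 1) with hw
      have h1 := Int.emod_nonneg w (b := (k : ℤ)) (by omega)
      have h2 := Int.emod_lt_of_pos w (b := (k : ℤ)) (by omega)
      have h3 := Int.emod_add_mul_ediv w k
      refine ⟨(w % k).toNat, by omega, ?_⟩
      rw [h.per, Int.toNat_of_nonneg h1]
      have hka : (k : ℤ) = 2 * a + 1 := by exact_mod_cast ha
      refine ⟨(l - i) - 2 * (w / k), ?_⟩
      have : w % k = w - k * (w / k) := by linarith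
      rw [this, hw]
      generalize (l - i) * ((a : ℤ) + 1) / k = u
      rw [hka]; ring
  by_cases hM : ∀ i, NN B r p q i
  · have := arc_MP (r := r) (C := B) (s := 2) (k - 1) 0 (fun j _ => by
      rcases h.step2 c (0 + 2 * j) with h1 | ⟨⟨j, h1, _⟩, _⟩
      · exact h1
      · exact absurd (hM j) h1) hinj
    exact h.ham c this (hM _) (hM _) (hset 0)
  · push Not at hM
    obtain ⟨j, hj⟩ := hM
    have := arc_SN (r := r) (C := B) (F := FF B r p q) (L := LL B r p q) (s := 2) (k - 1) (j + 1)
      (h.step2 c) hinj ⟨j, hj, by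
        rw [h.per]; exact ⟨2, by push_cast [Nat.sub_eq]; omega⟩⟩
    obtain ⟨z, hz, hm⟩ := h.snake c this
    exact h.ham c hm (h.L2 c hj) hz (hset _)

variable {m : ℕ}

lemma inj2 (h : Cfg R B (2 * m) r Q p q) (j : ℕ) (h1 : 0 < j) (h2 : j ≤ m - 1) (l : ℤ) :
    r l ≠ r (l + 2 * j) := h.ne_of_lt (by omega) (by push_cast; omega)

lemma mem2 (h : Cfg R B (2 * m) r Q p q) (i : ℤ) (v : V) :
    v ∈ arc r 2 i (m - 1) ↔ ∃ l : ℤ, v = r (i + 2 * l) := by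
  have hp := h.pos
  rw [mem_arc]
  constructor
  · rintro ⟨j, _, rfl⟩; exact ⟨j, rfl⟩
  · rintro ⟨l, rfl⟩
    have h1 := Int.emod_nonneg l (b := (m : ℤ)) (by omega)
    have h2 := Int.emod_lt_of_pos l (b := (m : ℤ)) (by omega)
    have h3 := Int.emod_add_mul_ediv l m
    refine ⟨(l % m).toNat, by omega, ?_⟩
    rw [h.per, Int.toNat_of_nonneg h1]
    refine ⟨-(l / m), ?_⟩
    push_cast
    linear_combination 2 * h3

lemma disj2 (h : Cfg R B (2 * m) r Q p q) {i j : ℤ} (hij : ¬ (2 : ℤ) ∣ i - j) :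
    Disjoint (arc r 2 i (m - 1)) (arc r 2 j (m - 1)) := by
  rw [Finset.disjoint_left]
  intro x hx hx'
  rw [h.mem2] at hx hx'
  obtain ⟨a, rfl⟩ := hx
  obtain ⟨b, e⟩ := hx'
  rw [h.per] at e
  apply hij
  have : (2 : ℤ) ∣ i + 2 * a - (j + 2 * b) := dvd_trans (by push_cast; exact Dvd.intro _ rfl) e
  omega

lemma union2 (h : Cfg R B (2 * m) r Q p q) {i j : ℤ} (hij : ¬ (2 : ℤ) ∣ i - j) :
    arc r 2 i (m - 1) ∪ arc r 2 j (m - 1) = Qᶜ := by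
  ext v
  rw [Finset.mem_union, h.mem2, h.mem2, Finset.mem_compl, h.mem]
  push Not
  constructor
  · rintro (⟨l, rfl⟩ | ⟨l, rfl⟩) <;> exact ⟨_, rfl⟩
  · rintro ⟨l, rfl⟩
    by_cases hl : (2 : ℤ) ∣ l - i
    · exact Or.inl ⟨(l - i) / 2, by congr 1; omega⟩
    · exact Or.inr ⟨(l - j) / 2, by congr 1; omega⟩

lemma sn2 (c : Ctx R B (2 * m)) (h : Cfg R B (2 * m) r Q p q) {j : ℤ} (hj : ¬ NN B r p q j) :
    SN B (FF B r p q) (LL B r p q) (arc r 2 (j + 1) (m - 1)) (r (j + 1)) := by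
  have hp := h.pos
  refine arc_SN (r := r) (s := 2) (m - 1) (j + 1) (h.step2 c) h.inj2 ⟨j, hj, ?_⟩
  rw [h.per]; exact ⟨1, by push_cast [Nat.sub_eq]; omega⟩

lemma L5 (c : Ctx R B (2 * m)) (h : Cfg R B (2 * m) r Q p q) {i j : ℤ} (hi : ¬ NN B r p q i)
    (hj : ¬ NN B r p q j) : (2 : ℤ) ∣ i - j := by
  by_contra hij
  have hd : ¬ (2 : ℤ) ∣ (i + 1) - (j + 1) := by simpa using hij
  obtain ⟨z, hz, hm⟩ := h.snake c ((h.sn2 c hi).append (h.sn2 c hj) (h.disj2 hd) ⟨j, hj, rfl⟩)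
  exact h.ham c hm (h.L2 c hi) hz (h.union2 hd)

lemma L6 (c : Ctx R B (2 * m)) (h : Cfg R B (2 * m) r Q p q) :
    (∀ l : ℤ, NN B r p q (2 * l + 1)) ∨ (∀ l : ℤ, NN B r p q (2 * l)) := by
  by_contra hh
  push Not at hh
  obtain ⟨⟨a, ha⟩, b, hb⟩ := hh
  have := h.L5 c ha hb
  omega

lemma path2 (c : Ctx R B (2 * m)) (h : Cfg R B (2 * m) r Q p q) (i : ℤ)
    (hN : ∀ l : ℤ, NN B r p q (i + 1 + 2 * l)) :
    MP B (arc r 2 i (m - 1)) (r i) (r (i - 2)) := by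
  have hp := h.pos
  have := arc_MP (r := r) (C := B) (s := 2) (m - 1) i (fun j _ => by
    have := h.L3' c (hN j)
    convert this using 2 <;> ring) h.inj2
  have e : r (i + 2 * ((m - 1 : ℕ) : ℤ)) = r (i - 2) := by
    rw [h.per]; exact ⟨1, by push_cast [Nat.sub_eq]; omega⟩
  rwa [e] at this

lemma set2 (h : Cfg R B (2 * m) r Q p q) {i j : ℤ} (hij : (2 : ℤ) ∣ i - j) :
    arc r 2 i (m - 1) = arc r 2 j (m - 1) := by
  ext v
  rw [h.mem2, h.mem2]
  constructor
  · rintro ⟨l, rfl⟩; exact ⟨l + (i - j) / 2, by congr 1; omega⟩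
  · rintro ⟨l, rfl⟩; exact ⟨l - (i - j) / 2, by congr 1; omega⟩

lemma erase2 (h : Cfg R B (2 * m) r Q p q) (hm : 2 ≤ m) (i : ℤ) :
    arc r 2 (i + 2) (m - 2) = (arc r 2 i (m - 1)).erase (r i) := by
  rw [show m - 1 = m - 2 + 1 by omega, arc_succ, Finset.erase_insert]
  rw [mem_arc]
  rintro ⟨j, hj, e⟩
  exact h.ne_of_lt (by omega) (by push_cast; omega) e.symm

end Cfg
end bt
end BT

namespace BT
set_option linter.unusedSectionVars false
set_option linter.unusedVariables false
section bt
variable {V : Type*} [DecidableEq V] [Fintype V] {R B : V → V → Prop}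
variable {k : ℕ} {r : ℤ → V} {Q : Finset V} {p q : V} {m : ℕ}
namespace Cfg

lemma core (c : Ctx R B (2 * m)) (h : Cfg R B (2 * m) r Q p q)
    (hodd : ∀ l : ℤ, NN B r p q (2 * l + 1)) (hN2 : NN B r p q 2)
    {q2 q3 : V} {Q3 : Finset V} (d1 : q2 ∉ Q3) (d2 : p ∉ Q3) (d3 : p ≠ q2)
    (d4 : Q = insert p (insert q2 Q3)) (d5 : B p q2) (d6 : B q2 q3) (d7 : MP B Q3 q3 q)
    (d8 : MP B (insert q2 Q3) q2 q)
    {z1 z2 : V} (e1 : MP B (arc r 2 1 (m - 1)) (r 1) z1)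
    (e2 : MP B ((arc r 2 1 (m - 1)).erase (r 1)) (r 3) z2) :
    B (r 0) p ∧ B (r 0) q3 ∧ ¬ B (r 1) q3 := by
  have h4 := h.four_le c
  have hEO := h.disj2 (i := 1) (j := 0) (by norm_num)
  have hU := h.union2 (i := 1) (j := 0) (by norm_num)
  have hmE := h.mem2 1
  have hE1 : r 1 ∈ arc r 2 1 (m - 1) := (hmE _).2 ⟨0, by simp⟩
  have hE3 : r 3 ∈ arc r 2 1 (m - 1) := (hmE _).2 ⟨1, by norm_num⟩
  have hNE : ∀ x ∈ arc r 2 1 (m - 1), B x p ∧ B x q := by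
    intro x hx
    obtain ⟨l, rfl⟩ := (hmE x).1 hx
    have := hodd l
    rwa [show 2 * l + 1 = 1 + 2 * l by ring] at this
  have o2 : MP B (arc r 2 0 (m - 1)) (r 2) (r 0) := by
    have := h.path2 c 2 (fun l => by convert hodd (l + 1) using 1; ring)
    rw [h.set2 (i := 2) (j := 0) (by norm_num)] at this
    simpa using this
  have o4 : MP B (arc r 2 0 (m - 1)) (r 4) (r 2) := by
    have := h.path2 c 4 (fun l => by convert hodd (l + 2) using 1; ring)
    rw [h.set2 (i := 4) (j := 0) (by norm_num)] at this
    simpa using this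
  have n1 := hNE _ hE1
  have n3 := hNE _ hE3
  have nz1 := hNE _ e1.right
  have nz2 := hNE _ (Finset.mem_of_mem_erase e2.right)
  have nQ0 := h.notQ 0
  have nQ1 := h.notQ 1
  have nQ2 := h.notQ 2
  have nQ3 := h.notQ 3
  have hO2 := o2.left
  have hne12 : r 1 ≠ r 2 := h.ne_of_lt (by norm_num) (by push_cast; omega)
  have hne23 : r 2 ≠ r 3 := h.ne_of_lt (by norm_num) (by push_cast; omega)
  generalize hEd : arc r 2 1 (m - 1) = E at *
  generalize hOd : arc r 2 0 (m - 1) = O at *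
  rw [Finset.disjoint_left] at hEO
  have hU' : ∀ x, (x ∈ E ∨ x ∈ O) ↔ x ∉ Q := by
    intro x
    have : x ∈ E ∪ O ↔ x ∈ Qᶜ := by rw [hU]
    simpa using this
  have hi : ¬ B (r 0) (r 3) := by
    intro hb
    have hP := o2.append e2 (by rw [Finset.disjoint_left]; grind [Finset.mem_compl]) hb
    have hc := h.close c hP hN2 nz2 (by rw [Finset.disjoint_left]; grind [Finset.mem_compl])
    refine c.bad hc (((MP.single (r 1)).cyc (c.Rr _)).congr ?_)
    ext x; simp; grind
  have hii : ¬ B (r 4) (r 1) := by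
    intro hb
    have hP := (o4.reverse c.Bs).append e1 (by rw [Finset.disjoint_left]; grind [Finset.mem_compl]) hb
    exact h.ham c hP hN2 nz1 (by rw [Finset.union_comm]; exact hU)
  have hiii : ¬ B (r 0) q2 := by
    intro hb
    have hP := ((o2.append d8 (by rw [Finset.disjoint_left]; grind [Finset.mem_compl]) hb).append e1
      (by rw [Finset.disjoint_left]; grind [Finset.mem_compl]) (c.Bs _ _ n1.2)).snoc (c := p) (by grind [Finset.mem_compl]) nz1.1
    refine c.badB (hP.cyc (c.Bs _ _ hN2.1)) ?_
    ext x; simp; grind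
  have hiv : ¬ B (r 1) q2 := by
    intro hb
    have hP := (MP.cons (R := B) (a := p) (by grind [Finset.mem_compl]) (c.Bs _ _ n1.1) (MP.cons (R := B) (a := r 1) (by grind [Finset.mem_compl]) hb d8)).snoc
      (c := r 2) (by grind [Finset.mem_compl]) (c.Bs _ _ hN2.2)
    have ha := h.arc2 1 (by omega)
    norm_num at ha
    refine c.bad (hP.cyc hN2.1) ((ha.cyc (c.nB hi)).congr ?_)
    ext x; simp; grind
  have hv : ¬ B (r 3) q2 := by
    intro hb
    have hP := (MP.cons (R := B) (a := p) (by grind [Finset.mem_compl]) (c.Bs _ _ n3.1) (MP.cons (R := B) (a := r 3) (by grind [Finset.mem_compl]) hb d8)).snoc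
      (c := r 2) (by grind [Finset.mem_compl]) (c.Bs _ _ hN2.2)
    have ha := h.arc2 2 (by omega)
    norm_num at ha
    refine c.bad (hP.cyc hN2.1) ((ha.cyc (c.Rs _ _ (c.nB hii))).congr ?_)
    ext x; simp; grind
  have h' := h.replace c (by omega) 2 (x := q2) (by grind [Finset.mem_compl]) (by norm_num; exact c.nB hiv)
    (by norm_num; exact c.Rs _ _ (c.nB hv))
    (MP.cons (R := B) (a := p) (by grind [Finset.mem_compl]) (c.Bs _ _ hN2.1) (MP.cons (R := B) (a := r 2) (by grind [Finset.mem_compl]) hN2.2 (d7.reverse c.Bs)))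
    (by ext x; simp; grind [Finset.mem_compl])
  have nd0 : ¬ ((2 * m : ℕ) : ℤ) ∣ 0 - 2 := by
    intro hd
    have := Int.le_of_dvd (by norm_num) ((dvd_neg).2 hd)
    omega
  have nd1 : ¬ ((2 * m : ℕ) : ℤ) ∣ 1 - 2 := by
    intro hd
    have := Int.le_of_dvd (by norm_num) ((dvd_neg).2 hd)
    omega
  have hn1 : ¬ NN B (fun j => if ((2 * m : ℕ) : ℤ) ∣ j - 2 then q2 else r j) p q3 1 := by
    intro hN
    have := h'.L3' c hN
    simp only [show (1 : ℤ) - 1 = 0 by norm_num, show (1 : ℤ) + 1 = 2 by norm_num, nd0, if_false, sub_self, dvd_zero, if_true] at this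
    exact hiii this
  have hn0 := h'.L2' c hn1
  simp only [NN, show (1 : ℤ) - 1 = 0 by norm_num, nd0, nd1, if_false] at hn0 hn1
  exact ⟨hn0.1, hn0.2, fun hh => hn1 ⟨n1.1, hh⟩⟩

/-- all N -/
lemma caseAll (c : Ctx R B (2 * m)) (h : Cfg R B (2 * m) r Q p q)
    (hN : ∀ i, NN B r p q i) : False := by
  have h4 := h.four_le c
  have key : ∀ (r : ℤ → V), Cfg R B (2 * m) r Q p q → (∀ i, NN B r p q i) →
      (∃ z, MP B (arc r 2 1 (m - 1)) (r 1) z) ∧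
      ∃ z, MP B ((arc r 2 1 (m - 1)).erase (r 1)) (r 3) z := by
    intro r h hN
    refine ⟨⟨_, h.path2 c 1 fun l => hN _⟩, ?_⟩
    have := arc_MP (r := r) (C := B) (s := 2) (m - 2) 3 (fun j _ => by
      have := h.L3' c (hN (3 + 2 * j + 1))
      convert this using 2 <;> ring) (fun j h1 h2 => h.inj2 j h1 (by omega))
    exact ⟨_, this.congr (by simpa using h.erase2 (by omega) 1)⟩
  obtain ⟨q2, q3, Q3, d1, d2, d3, d4, d5, d6, d7, d8⟩ := h.dec c
  obtain ⟨⟨z1, e1⟩, z2, e2⟩ := key _ h hN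
  have c1 := h.core c (fun l => hN _) (hN _) d1 d2 d3 d4 d5 d6 d7 d8 e1 e2
  have hN' : ∀ i, NN B (fun i => r (i + 1)) p q i := fun i => hN (i + 1)
  obtain ⟨⟨z1, e1⟩, z2, e2⟩ := key _ (h.shift 1) hN'
  have c2 := (h.shift 1).core c (fun l => hN' _) (hN' _) d1 d2 d3 d4 d5 d6 d7 d8 e1 e2
  exact c1.2.2 (by simpa using c2.2.1)

lemma caseA1 (c : Ctx R B (2 * m)) (h : Cfg R B (2 * m) r Q p q)
    (hodd : ∀ l : ℤ, NN B r p q (2 * l + 1)) (h0 : ¬ NN B r p q 0) (h2 : NN B r p q 2) :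
    False := by
  have h4 := h.four_le c
  wlog hp : ¬ B (r 0) p generalizing p q
  · have hs : ∀ i, NN B r q p i ↔ NN B r p q i := fun i => And.comm
    refine this (h.revQ c) (by simpa only [hs] using hodd) (by simpa only [hs] using h0)
      (by simpa only [hs] using h2) ?_
    intro hq
    exact h0 ⟨not_not.1 hp, hq⟩
  obtain ⟨q2, q3, Q3, d1, d2, d3, d4, d5, d6, d7, d8⟩ := h.dec c
  obtain ⟨z1, -, e1⟩ := h.snake c (h.sn2 c h0)
  have := arc_SN (r := r) (s := 2) (m - 2) 3 (h.step2 c) (fun j h1 h2 => h.inj2 j h1 (by omega))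
    ⟨0, h0, by rw [h.per]; exact ⟨1, by push_cast [Nat.sub_eq]; omega⟩⟩
  obtain ⟨z2, -, e2⟩ := h.snake c this
  have e2' := e2.congr (by simpa using h.erase2 (by omega) 1)
  exact hp (h.core c hodd h2 d1 d2 d3 d4 d5 d6 d7 d8 (by simpa using e1) e2').1

lemma alt (c : Ctx R B k) (h : Cfg R B k r Q p q) {i : ℤ}
    (hh : (¬ B (r (i - 1)) p ∧ ¬ B (r (i + 1)) q) ∨ (¬ B (r (i - 1)) q ∧ ¬ B (r (i + 1)) p))
    {q2 q3 : V} {Q3 : Finset V} (d1 : q2 ∉ Q3) (d2 : p ∉ Q3) (d3 : p ≠ q2)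
    (d4 : Q = insert p (insert q2 Q3)) (d5 : B p q2)
    (d8 : MP B (insert q2 Q3) q2 q) : ¬ B (r i) q2 := by
  intro hb
  have h4 := h.four_le c
  have hpq := h.pne c
  have hR := c.nB (h.L1 c)
  have hqQ := h.path.right
  have hpQ := h.path.left
  have hni := h.notQ i
  obtain ⟨u, v, hm, hu, hv⟩ : ∃ u v, MP R (Qᶜ.erase (r i)) u v ∧ R v p ∧ R q u := by
    rcases hh with ⟨h1, h2⟩ | ⟨h1, h2⟩
    · exact ⟨_, _, h.arc1 i (by omega), c.nB h1, c.Rs _ _ (c.nB h2)⟩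
    · exact ⟨_, _, (h.arc1 i (by omega)).reverse c.Rs, c.nB h2, c.Rs _ _ (c.nB h1)⟩
  have hP := (hm.snoc (c := p) (by grind [Finset.mem_compl]) hu).snoc (c := q) (by grind [Finset.mem_compl]) hR
  have hne : q ≠ q2 := by rintro rfl; exact h.L1 c d5
  obtain ⟨y, T, h9, h10, h11, h12⟩ := (d8.reverse c.Bs).unconsNe hne
  have hT := MP.cons (R := B) (a := r i) (by grind [Finset.mem_compl]) hb (h12.reverse c.Bs)
  have hTm : ∀ x, x ∈ T ↔ x ∈ Q ∧ x ≠ p ∧ x ≠ q := by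
    intro x
    have : x ∈ insert q2 Q3 ↔ x ∈ insert q T := by rw [h10]
    have hp2 : p ∉ insert q2 Q3 := by simp [d2, d3]
    rw [d4]; simp only [Finset.mem_insert] at *; grind
  refine c.big (hP.cyc hv) (hT.congr ?_) ?_
  · ext x; simp; grind
  · rw [Finset.card_insert_of_notMem (by grind [Finset.mem_compl]), Finset.card_insert_of_notMem (by grind [Finset.mem_compl]),
      Finset.card_erase_of_mem (by simpa using hni), h.card]
    omega

lemma good (c : Ctx R B (2 * m)) (h : Cfg R B (2 * m) r Q p q)
    (h0 : ¬ B (r 0) p) (h2 : ¬ B (r 2) p) (hN : NN B r p q 1)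
    {q2 q3 : V} {Q3 : Finset V} (d1 : q2 ∉ Q3) (d2 : p ∉ Q3) (d3 : p ≠ q2)
    (d4 : Q = insert p (insert q2 Q3))
    (d8 : MP B (insert q2 Q3) q2 q) :
    ¬ B (r 1) q2 ∧ ∀ l : ℤ, r (2 * l + 1) ≠ r 1 → B (r (2 * l + 1)) q2 := by
  have h4 := h.four_le c
  have hn1 := h.notQ 1
  have h' := h.replace c (by omega) 1 (x := p) h.path.left (by norm_num; exact c.nB h0)
    (by norm_num; exact c.Rs _ _ (c.nB h2)) (d8.snoc (c := r 1) (by grind [Finset.mem_compl]) (c.Bs _ _ hN.2))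
    (by ext x; simp; grind [Finset.mem_compl])
  refine ⟨fun hb => h'.L1 c (c.Bs _ _ hb), ?_⟩
  have nd0 : ¬ ((2 * m : ℕ) : ℤ) ∣ 0 - 1 := by
    intro hd
    have := Int.le_of_dvd (by norm_num) ((dvd_neg).2 hd)
    omega
  have hne : r 0 ≠ r 1 := h.ne_of_lt (by norm_num) (by push_cast; omega)
  rcases h'.L6 c with H | H
  · intro l hl
    have := (H l).1
    rw [Ne, h.per] at hl
    simpa only [hl, if_false] using this
  · exfalso
    have := (H 0).2
    simp only [mul_zero, nd0, if_false] at this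
    exact hne (c.ex _ _ (by simpa using h.red 0) this)

lemma caseI (c : Ctx R B (2 * m)) (h : Cfg R B (2 * m) r Q p q)
    (hodd : ∀ l : ℤ, NN B r p q (2 * l + 1)) (hev : ∀ l : ℤ, ¬ NN B r p q (2 * l))
    (h0 : ¬ B (r 0) p) (h2 : ¬ B (r 2) p) : False := by
  have h4 := h.four_le c
  obtain ⟨q2, q3, Q3, d1, d2, d3, d4, d5, d6, d7, d8⟩ := h.dec c
  have g := (h.good c (q3 := q3) h0 h2 (by simpa using hodd 0) d1 d2 d3 d4 d8).2 1
    (h.ne_of_lt (by norm_num) (by push_cast; omega)).symm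
  norm_num at g
  by_cases h4p : B (r 4) p
  · have h4q : ¬ B (r 4) q := fun hq => hev 2 ⟨by simpa using h4p, by simpa using hq⟩
    exact h.alt c (q3 := q3) (i := 3) (Or.inl ⟨by simpa using h2, by simpa using h4q⟩) d1 d2 d3 d4 d5 d8 g
  · have := ((h.shift 2).good c (q3 := q3) (by simpa using h2) (by simpa using h4p) (by
      have := hodd 1; simpa [NN] using this) d1 d2 d3 d4 d8).1
    exact this (by simpa using g)

lemma caseA2 (c : Ctx R B (2 * m)) (h : Cfg R B (2 * m) r Q p q)
    (hodd : ∀ l : ℤ, NN B r p q (2 * l + 1)) (hev : ∀ l : ℤ, ¬ NN B r p q (2 * l)) : False := by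
  wlog h0 : ¬ B (r 0) p generalizing p q
  · have hs : ∀ i, NN B r q p i ↔ NN B r p q i := fun i => And.comm
    refine this (h.revQ c) (by simpa only [hs] using hodd) (by simpa only [hs] using hev) ?_
    intro hq
    exact hev 0 ⟨by simpa using not_not.1 h0, by simpa using hq⟩
  have h4 := h.four_le c
  by_cases h2p : B (r 2) p
  swap
  · exact h.caseI c hodd hev h0 h2p
  have h2q : ¬ B (r 2) q := fun hq => hev 1 ⟨by simpa using h2p, by simpa using hq⟩
  by_cases h4q : B (r 4) q
  swap
  · refine ((h.revQ c).shift 2).caseI c (fun l => ?_) (fun l hl => ?_) (by simpa using h2q) (by simpa using h4q)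
    · have := hodd (l + 1)
      rw [show 2 * (l + 1) + 1 = 2 * l + 1 + 2 by ring] at this
      exact this.symm
    · apply hev (l + 1)
      rw [show 2 * (l + 1) = 2 * l + 2 by ring]
      exact hl.symm
  have h4p : ¬ B (r 4) p := fun hp => hev 2 ⟨by simpa using hp, by simpa using h4q⟩
  obtain ⟨q2, q3, Q3, d1, d2, d3, d4, d5, d6, d7, d8⟩ := h.dec c
  have a1 := h.alt c (q3 := q3) (i := 1) (Or.inl ⟨by simpa using h0, by simpa using h2q⟩) d1 d2 d3 d4 d5 d8
  have a3 := h.alt c (q3 := q3) (i := 3) (Or.inr ⟨by simpa using h2q, by simpa using h4p⟩) d1 d2 d3 d4 d5 d8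
  have hpq := h.pne c
  have hR := c.nB (h.L1 c)
  have hqQ := h.path.right
  have hpQ := h.path.left
  have hn1 := h.notQ 1
  have hn2 := h.notQ 2
  have hn3 := h.notQ 3
  have hne2 : q ≠ q2 := by rintro rfl; exact h.L1 c d5
  have r12 := c.Rs _ _ (h.red 1)
  have r34 := h.red 3
  norm_num at r12 r34
  have hne12 : r 1 ≠ r 2 := h.ne_of_lt (by norm_num) (by push_cast; omega)
  have hne23 : r 2 ≠ r 3 := h.ne_of_lt (by norm_num) (by push_cast; omega)
  have hne13 : r 1 ≠ r 3 := h.ne_of_lt (by norm_num) (by push_cast; omega)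
  have ha := h.arc3 1 (by omega)
  norm_num at ha
  have hq2Q : q2 ∈ Q := by rw [d4]; simp
  have hP := (((((ha.snoc (c := p) (by grind [Finset.mem_compl]) (c.nB h0)).snoc (c := q) (by grind [Finset.mem_compl]) hR).snoc (c := r 2) (by grind [Finset.mem_compl])
    (c.Rs _ _ (c.nB h2q))).snoc (c := r 1) (by grind [Finset.mem_compl]) r12).snoc (c := q2) (by grind [Finset.mem_compl]) (c.nB a1)).snoc
    (c := r 3) (by grind [Finset.mem_compl]) (c.Rs _ _ (c.nB a3))
  have hQ3 : ∀ x, x ∈ Q3 ↔ x ∈ Q ∧ x ≠ p ∧ x ≠ q2 := by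
    intro x; rw [d4]; simp only [Finset.mem_insert]; grind
  rcases (d7.reverse c.Bs).uncons with ⟨h9, h10⟩ | ⟨y, T, h9, h10, h11, h12⟩
  · refine c.bad (T := ∅) (Or.inl rfl) ((hP.cyc r34).congr ?_)
    ext x; simp; grind
  · have hTm : ∀ x, x ∈ T ↔ x ∈ Q ∧ x ≠ p ∧ x ≠ q2 ∧ x ≠ q := by
      intro x
      have : x ∈ Q3 ↔ x ∈ insert q T := by rw [h10]
      simp only [Finset.mem_insert] at *; grind
    refine c.big (hP.cyc r34) (h12.congr ?_) ?_
    · ext x; simp; grind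
    · have : Qᶜ ∪ {p, q} ⊆ insert (r 3) (insert q2 (insert (r 1) (insert (r 2) (insert q (insert p
        (((Qᶜ.erase (r 1)).erase (r 2)).erase (r 3))))))) := by
        intro x; simp; grind
      have h5 := Finset.card_le_card this
      rw [Finset.card_union_of_disjoint (by rw [Finset.disjoint_left]; intro x; simp; grind [Finset.mem_compl]), h.card,
        Finset.card_pair hpq] at h5
      omega

theorem noCfg (c : Ctx R B k) (h : Cfg R B k r Q p q) : False := by
  obtain ⟨m, hm⟩ := h.even c
  obtain rfl : k = 2 * m := by omega
  clear hm
  wlog hodd : ∀ l : ℤ, NN B r p q (2 * l + 1) generalizing r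
  · have hev := (h.L6 c).resolve_left hodd
    refine this (h.shift 1) (fun l => ?_)
    have := hev (l + 1)
    rw [show 2 * (l + 1) = 2 * l + 1 + 1 by ring] at this
    exact this
  by_cases hA : ∀ l : ℤ, NN B r p q (2 * l)
  · refine h.caseAll c (fun i => ?_)
    rcases Int.even_or_odd' i with ⟨l, rfl | rfl⟩
    · exact hA l
    · exact hodd l
  by_cases hA2 : ∀ l : ℤ, ¬ NN B r p q (2 * l)
  · exact h.caseA2 c hodd hA2
  push Not at hA hA2
  obtain ⟨a, ha⟩ := hA
  obtain ⟨b, hb⟩ := hA2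
  -- find consecutive
  obtain ⟨l, hl, hl'⟩ : ∃ l : ℤ, ¬ NN B r p q (2 * l) ∧ NN B r p q (2 * l + 2) := by
    by_contra hcon
    push Not at hcon
    have : ∀ n : ℕ, ¬ NN B r p q (2 * (a + n)) := by
      intro n
      induction n with
      | zero => simpa using ha
      | succ n ih =>
        have := hcon _ ih
        push_cast
        rwa [show 2 * (a + n) + 2 = 2 * (a + ((n : ℤ) + 1)) by ring] at this
    have hp := h.pos
    have h1 := Int.emod_nonneg (b - a) (b := (m : ℤ)) (by omega)
    have h3 := Int.emod_add_mul_ediv (b - a) m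
    apply this ((b - a) % m).toNat
    rw [Int.toNat_of_nonneg h1]
    rw [nn_congr (j := 2 * b)]
    · exact hb
    · rw [h.per]; exact ⟨-((b - a) / m), by push_cast; linear_combination 2 * h3⟩
  refine (h.shift (2 * l)).caseA1 c (fun j => ?_) (fun hj => ?_) ?_
  · have := hodd (j + l)
    rw [show 2 * (j + l) + 1 = 2 * j + 1 + 2 * l by ring] at this
    exact this
  · apply hl; simpa [NN] using hj
  · rw [add_comm] at hl'; exact hl'

end Cfg
end bt
end BT

namespace BT
set_option linter.unusedSectionVars false
set_option linter.unusedVariables false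
section bt
variable {V : Type*} [DecidableEq V] {R B : V → V → Prop}

lemma MP.fn {S : Finset V} {a b : V} (h : MP R S a b) : ∃ (n : ℕ) (f : ℕ → V),
    f 0 = a ∧ f n = b ∧ (∀ i < n, R (f i) (f (i + 1))) ∧ S.card = n + 1 ∧
    (∀ v, v ∈ S ↔ ∃ i ≤ n, f i = v) ∧ (∀ i ≤ n, ∀ j ≤ n, f i = f j → i = j) := by
  induction h with
  | single a => exact ⟨0, fun _ => a, rfl, rfl, by simp, by simp, by simp [eq_comm], by intros; omega⟩
  | @cons a b c S h1 h2 h3 ih =>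
    obtain ⟨n, f, e1, e2, e3, e4, e5, e6⟩ := ih
    refine ⟨n + 1, fun i => if i = 0 then a else f (i - 1), by simp, by simpa using e2, ?_, ?_, ?_, ?_⟩
    · intro i hi
      rcases i with _ | i
      · simpa [e1] using h2
      · simpa using e3 i (by omega)
    · rw [Finset.card_insert_of_notMem h1, e4]
    · intro v
      rw [Finset.mem_insert, e5]
      constructor
      · rintro (rfl | ⟨i, hi, rfl⟩)
        · exact ⟨0, by simp⟩
        · exact ⟨i + 1, by omega, by simp⟩
      · rintro ⟨i, hi, rfl⟩
        rcases i with _ | i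
        · simp
        · right; exact ⟨i, by omega, by simp⟩
    · intro i hi j hj hij
      rcases i with _ | i <;> rcases j with _ | j
      · rfl
      · simp at hij; exact absurd ((e5 a).2 ⟨j, by omega, hij.symm⟩) h1
      · simp at hij; exact absurd ((e5 a).2 ⟨i, by omega, hij⟩) h1
      · simp at hij; rw [e6 i (by omega) j (by omega) hij]

variable [Fintype V]

lemma Cfg.ofMP {S T : Finset V} {a b p q : V} (hS : MP R S a b) (hr : R b a) (hT : MP B T p q)
    (hd : Disjoint S T) (hu : S ∪ T = Finset.univ) : ∃ r, Cfg R B S.card r T p q := by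
  obtain ⟨n, f, e1, e2, e3, e4, e5, e6⟩ := hS.fn
  rw [e4]
  have hn : ∀ i : ℤ, 0 ≤ i % ((n + 1 : ℕ) : ℤ) ∧ i % ((n + 1 : ℕ) : ℤ) < n + 1 := fun i =>
    ⟨Int.emod_nonneg _ (by omega), by
      have := Int.emod_lt_of_pos i (b := ((n + 1 : ℕ) : ℤ)) (by omega); push_cast at *; exact this⟩
  refine ⟨fun i => f (i % ((n + 1 : ℕ) : ℤ)).toNat, by omega, ?_, ?_, hT, ?_⟩
  · intro i j
    have h1 := hn i
    have h2 := hn j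
    rw [Int.dvd_iff_emod_eq_zero, ← Int.emod_eq_emod_iff_emod_sub_eq_zero]
    constructor
    · intro he
      have := e6 _ (by omega) _ (by omega) he
      omega
    · intro he; simp only [he]
  · intro i
    have h1 := hn i
    have h2 := hn (i + 1)
    have h3 := Int.emod_add_mul_ediv i ((n + 1 : ℕ) : ℤ)
    by_cases hl : i % ((n + 1 : ℕ) : ℤ) = n
    · have : (i + 1) % ((n + 1 : ℕ) : ℤ) = 0 := by
        rw [← Int.dvd_iff_emod_eq_zero]
        refine ⟨i / ((n + 1 : ℕ) : ℤ) + 1, ?_⟩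
        rw [hl] at h3
        push_cast at *; linarith
      simp only [this, hl]
      simpa [e1, e2] using hr
    · have : (i + 1) % ((n + 1 : ℕ) : ℤ) = i % ((n + 1 : ℕ) : ℤ) + 1 := by
        rw [Int.add_emod]
        rcases n with _ | n
        · push_cast at *; omega
        · rw [Int.emod_eq_of_lt (a := 1) (by norm_num) (by push_cast; omega)]
          exact Int.emod_eq_of_lt (by omega) (by push_cast at *; omega)
      have h4 := e3 (i % ((n + 1 : ℕ) : ℤ)).toNat (by omega)
      simp only [this]
      convert h4 using 2
      omega
  · intro v
    have hv : v ∈ T ↔ v ∉ S := by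
      have : v ∈ S ∪ T := by rw [hu]; simp
      rw [Finset.disjoint_left] at hd
      have := hd (a := v)
      simp at *; tauto
    rw [hv, e5]
    push Not
    constructor
    · intro H i; exact H _ (by have := hn i; omega)
    · intro H i hi
      have := H i
      rwa [Int.emod_eq_of_lt (by omega) (by push_cast; omega), Int.toNat_natCast] at this

lemma main_half (Rs : ∀ a b, R a b → R b a) (Bs : ∀ a b, B a b → B b a) (Rr : ∀ a, R a a)
    (Br : ∀ a, B a a) (tot : ∀ a b, R a b ∨ B a b) (ex : ∀ a b, R a b → B a b → a = b)
    (nd : ¬ Done R B)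
    (h : ∃ S T a b, S.Nonempty ∧ Cyc R S ∧ MP B T a b ∧ Disjoint S T ∧ S ∪ T = Finset.univ) :
    False := by
  classical
  let F : Finset (Finset V) := Finset.univ.filter
    (fun S => Cyc R S ∧ ∃ T a b, MP B T a b ∧ Disjoint S T ∧ S ∪ T = Finset.univ)
  obtain ⟨S0, T0, a0, b0, h1, h2, h3, h4, h5⟩ := h
  have hS0 : S0 ∈ F := by simp only [F, Finset.mem_filter, Finset.mem_univ, true_and]; exact ⟨h2, T0, a0, b0, h3, h4, h5⟩
  obtain ⟨S, hS, hmax⟩ := F.exists_max_image Finset.card ⟨S0, hS0⟩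
  have hS' := hS
  simp only [F, Finset.mem_filter, Finset.mem_univ, true_and] at hS'
  obtain ⟨hc, T, p, q, hT, hd, hu⟩ := hS'
  have hne : S.Nonempty := Finset.card_pos.1 (lt_of_lt_of_le (Finset.card_pos.2 h1) (hmax _ hS0))
  rcases hc with rfl | ⟨a, b, hm, hr⟩
  · simp at hne
  obtain ⟨r, hcfg⟩ := Cfg.ofMP hm hr hT hd hu
  refine hcfg.noCfg ⟨Rs, Bs, Rr, Br, tot, ex, nd, ?_⟩
  intro S' T' a' b' k1 k2 k3 k4
  apply hmax
  simp only [F, Finset.mem_filter, Finset.mem_univ, true_and]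
  exact ⟨k1, T', a', b', k2, k3, k4⟩

lemma Done.swap (h : Done R B) : Done B R := by
  obtain ⟨S, T, h1, h2, h3, h4⟩ := h
  exact ⟨T, S, h1.symm, by rw [Finset.union_comm]; exact h2, h4, h3⟩

theorem main (Rs : ∀ a b, R a b → R b a) (Bs : ∀ a b, B a b → B b a) (Rr : ∀ a, R a a)
    (Br : ∀ a, B a a) (tot : ∀ a b, R a b ∨ B a b) (ex : ∀ a b, R a b → B a b → a = b) :
    Done R B := by
  by_contra nd
  have nd' : ¬ Done B R := fun h => nd h.swap
  have H1 := fun S T a b (h1 : S.Nonempty) (h2 : Cyc R S) (h3 : MP B T a b) (h4 : Disjoint S T)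
    (h5 : S ∪ T = Finset.univ) => main_half Rs Bs Rr Br tot ex nd ⟨S, T, a, b, h1, h2, h3, h4, h5⟩
  have H2 := fun S T a b (h1 : S.Nonempty) (h2 : Cyc B S) (h3 : MP R T a b) (h4 : Disjoint S T)
    (h5 : S ∪ T = Finset.univ) => main_half Bs Rs Br Rr (fun a b => (tot a b).symm)
      (fun a b x y => ex a b y x) nd' ⟨S, T, a, b, h1, h2, h3, h4, h5⟩
  -- versions allowing an empty remainder
  have G1 : ∀ S, S.Nonempty → Cyc R S → (Sᶜ = ∅ ∨ ∃ a b, MP B Sᶜ a b) → False := by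
    rintro S h1 h2 (h3 | ⟨a, b, h3⟩)
    · exact nd ⟨S, Sᶜ, disjoint_compl_right, Finset.union_compl S, h2, Or.inl h3⟩
    · exact H1 S Sᶜ a b h1 h2 h3 disjoint_compl_right (Finset.union_compl S)
  have G2 : ∀ S, S.Nonempty → Cyc B S → (Sᶜ = ∅ ∨ ∃ a b, MP R Sᶜ a b) → False := by
    rintro S h1 h2 (h3 | ⟨a, b, h3⟩)
    · exact nd' ⟨S, Sᶜ, disjoint_compl_right, Finset.union_compl S, h2, Or.inl h3⟩
    · exact H2 S Sᶜ a b h1 h2 h3 disjoint_compl_right (Finset.union_compl S)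
  rcases isEmpty_or_nonempty V with hV | hV
  · exact nd ⟨∅, ∅, by simp, by ext x; exact (hV.false x).elim, Or.inl rfl, Or.inl rfl⟩
  obtain ⟨S, T, v, a, b, hU, hI, hS, hT⟩ := exists_RB Rs Bs (Finset.univ : Finset V) Finset.univ_nonempty
    (fun a _ b _ => tot a b)
  have hU' : ∀ x, x ∈ S ∨ x ∈ T := fun x => by
    have : x ∈ S ∪ T := by rw [hU]; simp
    simpa using this
  have hI' : ∀ x, (x ∈ S ∧ x ∈ T) ↔ x = v := fun x => by
    have : x ∈ S ∩ T ↔ x ∈ ({v} : Finset V) := by rw [hI]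
    simpa using this
  have hvS := hS.left
  have hvT := hT.left
  have hbT := hT.right
  have haS := hS.right
  rcases tot v a with hva | hva
  · refine G1 S ⟨v, hvS⟩ (hS.cyc (Rs _ _ hva)) ?_
    rcases hT.uncons with ⟨h1, h2⟩ | ⟨c, T', h1, h2, h3, h4⟩
    · left; ext x; simp; grind
    · right; exact ⟨_, _, h4.congr (by ext x; simp; grind)⟩
  rcases tot v b with hvb | hvb
  swap
  · refine G2 T ⟨v, hvT⟩ (hT.cyc (Bs _ _ hvb)) ?_
    rcases hS.uncons with ⟨h1, h2⟩ | ⟨c, T', h1, h2, h3, h4⟩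
    · left; ext x; simp; grind
    · right; exact ⟨_, _, h4.congr (by ext x; simp; grind)⟩
  by_cases hvav : v = a
  · subst hvav
    refine G1 S ⟨v, hvS⟩ (hS.cyc (Rr _)) ?_
    rcases hT.uncons with ⟨h1, h2⟩ | ⟨c, T', h1, h2, h3, h4⟩
    · left; ext x; simp; grind
    · right; exact ⟨_, _, h4.congr (by ext x; simp; grind)⟩
  by_cases hvbv : v = b
  · subst hvbv
    refine G2 T ⟨v, hvT⟩ (hT.cyc (Br _)) ?_
    rcases hS.uncons with ⟨h1, h2⟩ | ⟨c, T', h1, h2, h3, h4⟩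
    · left; ext x; simp; grind
    · right; exact ⟨_, _, h4.congr (by ext x; simp; grind)⟩
  rcases tot a b with hab | hab
  · refine G1 (insert b S) ⟨v, by simp [hvS]⟩ ((hS.snoc (c := b) (by grind) hab).cyc (Rs _ _ hvb)) ?_
    obtain ⟨c, T', h1, h2, h3, h4⟩ := hT.unconsNe hvbv
    rcases (h4.reverse Bs).uncons with ⟨k1, k2⟩ | ⟨d, T'', k1, k2, k3, k4⟩
    · left; ext x; simp; grind
    · right; exact ⟨_, _, k4.congr (by ext x; simp; grind)⟩
  · refine G2 (insert a T) ⟨v, by simp [hvT]⟩ ((hT.snoc (c := a) (by grind) (Bs _ _ hab)).cyc (Bs _ _ hva)) ?_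
    obtain ⟨c, T', h1, h2, h3, h4⟩ := hS.unconsNe hvav
    rcases (h4.reverse Rs).uncons with ⟨k1, k2⟩ | ⟨d, T'', k1, k2, k3, k4⟩
    · left; ext x; simp; grind
    · right; exact ⟨_, _, k4.congr (by ext x; simp; grind)⟩

end bt
end BT

namespace BT
set_option linter.unusedSectionVars false
set_option linter.unusedVariables false
section red
variable {V : Type*} [DecidableEq V] {R B : V → V → Prop}

lemma Cyc.map {W : Type*} [DecidableEq W] {R' : W → W → Prop} (f : V → W)
    (hf : Function.Injective f) {S : Finset V} (h : Cyc R S)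
    (hR : ∀ x y, R x y → R' (f x) (f y)) : Cyc R' (S.image f) := by
  rcases h with rfl | ⟨a, b, h, hr⟩
  · left; simp
  · exact Or.inr ⟨f a, f b, h.map f hf (fun x _ y _ => hR x y), hR _ _ hr⟩

/-- colour relation -/
def Rc (χ : V → V → ℕ) (c : ℕ) (a b : V) : Prop := a = b ∨ χ a b = c
def nRc (χ : V → V → ℕ) (c : ℕ) (a b : V) : Prop := a = b ∨ χ a b ≠ c

def Good [Fintype V] (χ : V → V → ℕ) : Prop :=
  ∃ (S T : Finset V) (c c' : ℕ), c ≠ c' ∧ Cyc (Rc χ c) S ∧ Cyc (Rc χ c') T ∧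
    Disjoint S T ∧ S ∪ T = Finset.univ

variable {χ : V → V → ℕ}

lemma Rc.symm (hs : ∀ u v, χ u v = χ v u) (c : ℕ) (a b : V) (h : Rc χ c a b) : Rc χ c b a := by
  rcases h with h | h
  · exact Or.inl h.symm
  · exact Or.inr (by rw [hs]; exact h)

lemma nRc.symm (hs : ∀ u v, χ u v = χ v u) (c : ℕ) (a b : V) (h : nRc χ c a b) : nRc χ c b a := by
  rcases h with h | h
  · exact Or.inl h.symm
  · exact Or.inr (by rw [hs]; exact h)

lemma cover (hs : ∀ u v, χ u v = χ v u) (c : ℕ) (W : Finset V) :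
    ∃ S T, Disjoint S T ∧ S ∪ T = W ∧ Cyc (Rc χ c) S ∧ Cyc (nRc χ c) T := by
  have := main (V := W) (R := fun a b => Rc χ c a b) (B := fun a b => nRc χ c a b)
    (fun a b => Rc.symm hs c a b) (fun a b => nRc.symm hs c a b) (fun a => Or.inl rfl)
    (fun a => Or.inl rfl) (by intro a b; simp only [Rc, nRc]; tauto)
    (by intro a b h1 h2; simp only [Rc, nRc] at *; apply Subtype.ext; tauto)
  obtain ⟨S, T, h1, h2, h3, h4⟩ := this
  refine ⟨S.image Subtype.val, T.image Subtype.val, ?_, ?_,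
    h3.map _ Subtype.val_injective (fun x y h => h), h4.map _ Subtype.val_injective (fun x y h => h)⟩
  · exact (Finset.disjoint_image Subtype.val_injective).2 h1
  · rw [← Finset.image_union, h2]
    ext x; simp

def GoodV (χ : V → V → ℕ) (c : ℕ) (x : V) : Prop := ∃ d, ∀ y, y ≠ x → χ x y = c ∨ χ x y = d

lemma mono_path {c c' : ℕ} (hs : ∀ u v, χ u v = χ v u) {S : Finset V} {w b : V} (h : MP (nRc χ c) S w b)
    (hg : ∀ x ∈ S, GoodV χ c x) (hw : ∀ y, y ≠ w → χ w y = c ∨ χ w y = c') :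
    MP (Rc χ c') S w b ∧ ∀ y, y ≠ b → χ b y = c ∨ χ b y = c' := by
  induction h with
  | single a => exact ⟨MP.single a, hw⟩
  | @cons a b e S h1 h2 h3 ih =>
    have hne : a ≠ b := by rintro rfl; exact h1 h3.left
    have hab : χ a b ≠ c := h2.resolve_left hne
    have hab' : χ a b = c' := (hw b hne.symm).resolve_left hab
    have hb : ∀ y, y ≠ b → χ b y = c ∨ χ b y = c' := by
      obtain ⟨d, hd⟩ := hg b (by simp [h3.left])
      have h4 := hd a hne
      rw [hs b a] at h4
      have : d = c' := by rcases h4 with h4 | h4 <;> omega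
      rw [← this]; exact hd
    obtain ⟨k1, k2⟩ := ih (fun x hx => hg x (by simp [hx])) hb
    exact ⟨MP.cons h1 (Or.inr hab') k1, k2⟩

lemma mono {c : ℕ} (hs : ∀ u v, χ u v = χ v u) {T : Finset V} (h : Cyc (nRc χ c) T) (v0 : V)
    (hg : ∀ x ∈ T, x ≠ v0 → GoodV χ c x) : ∃ c', c' ≠ c ∧ Cyc (Rc χ c') T := by
  rcases T.eq_empty_or_nonempty with rfl | hne
  · exact ⟨c + 1, by omega, Or.inl rfl⟩
  obtain ⟨v, hv, hv0⟩ : ∃ v ∈ T, ∀ x ∈ T, x ≠ v → GoodV χ c x := by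
    by_cases h0 : v0 ∈ T
    · exact ⟨v0, h0, hg⟩
    · obtain ⟨v, hv⟩ := hne
      exact ⟨v, hv, fun x hx _ => hg x hx (by rintro rfl; exact h0 hx)⟩
  obtain ⟨b, hm, hr⟩ := h.rotate hv
  rcases hm.uncons with ⟨rfl, rfl⟩ | ⟨w, T', h1, rfl, h3, h4⟩
  · exact ⟨c + 1, by omega, (MP.single _).cyc (Or.inl rfl)⟩
  · have hvw : v ≠ w := by rintro rfl; exact h1 h4.left
    have hvb : b ≠ v := by rintro rfl; exact h1 h4.right
    have hc := h3.resolve_left hvw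
    have hc2 := hr.resolve_left hvb
    have hg' : ∀ x ∈ T', GoodV χ c x := fun x hx => hv0 x (by simp [hx]) (by rintro rfl; exact h1 hx)
    obtain ⟨k1, k2⟩ := mono_path (c' := χ v w) hs h4 hg' (by
      obtain ⟨d, hd⟩ := hg' w h4.left
      have h5 := hd v hvw
      rw [hs w v] at h5
      have : d = χ v w := by rcases h5 with h5 | h5 <;> omega
      rw [← this]; exact hd)
    exact ⟨χ v w, hc, (MP.cons h1 (Or.inr rfl) k1).cyc (Or.inr ((k2 v hvb.symm).resolve_left hc2))⟩

lemma insert_pairs (Rs : ∀ a b, R a b → R b a) (n : ℕ) : ∀ (X Y S : Finset V) (u b : V), X.card = n → Y.card = n →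
    Disjoint X Y → Disjoint S X → Disjoint S Y → (∀ y ∈ Y, ∀ z, R y z) → (∀ z, R u z) →
    MP R S u b → ∃ u', (∀ z, R u' z) ∧ MP R (S ∪ X ∪ Y) u' b := by
  induction n with
  | zero =>
    intro X Y S u b hX hY _ _ _ _ hu hm
    rw [Finset.card_eq_zero] at hX hY
    subst hX hY
    exact ⟨u, hu, by simpa using hm⟩
  | succ n ih =>
    intro X Y S u b hX hY h1 h2 h3 hYu hu hm
    obtain ⟨x, X', hx, rfl, hX'⟩ := Finset.card_eq_succ.1 hX
    obtain ⟨y, Y', hy, rfl, hY'⟩ := Finset.card_eq_succ.1 hY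
    rw [Finset.disjoint_left] at h1 h2 h3
    have h1' : ∀ z, (z = x ∨ z ∈ X') → ¬ (z = y ∨ z ∈ Y') := by
      intro z hz hz'; exact h1 (by simpa using hz) (by simpa using hz')
    have h2' : ∀ z, z ∈ S → ¬ (z = x ∨ z ∈ X') := by
      intro z hz hz'; exact h2 hz (by simpa using hz')
    have h3' : ∀ z, z ∈ S → ¬ (z = y ∨ z ∈ Y') := by
      intro z hz hz'; exact h3 hz (by simpa using hz')
    have hm' : MP R (insert y (insert x S)) y b :=
      MP.cons (by clear ih h1 h2 h3 hm hu hYu; grind) (hYu y (by simp) x) (MP.cons (by clear ih h1 h2 h3 hm hu hYu; grind) (Rs _ _ (hu x)) hm)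
    have d1 : Disjoint X' Y' := by rw [Finset.disjoint_left]; clear ih h1 h2 h3 hm hu hYu; grind
    have d2 : Disjoint (insert y (insert x S)) X' := by rw [Finset.disjoint_left]; clear ih h1 h2 h3 hm hu hYu; grind
    have d3 : Disjoint (insert y (insert x S)) Y' := by rw [Finset.disjoint_left]; clear ih h1 h2 h3 hm hu hYu; grind
    obtain ⟨u', k1, k2⟩ := ih X' Y' _ _ _ hX' hY' d1 d2 d3
      (fun z hz => hYu z (by simp [hz])) (hYu y (by simp)) hm'
    refine ⟨u', k1, k2.congr ?_⟩
    ext z; simp only [Finset.mem_union, Finset.mem_insert]; tauto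

variable [Fintype V]

def Col (χ : V → V → ℕ) (v : V) : Finset ℕ := (Finset.univ.erase v).image (χ v)

lemma mem_col {u v : V} (h : v ≠ u) : χ u v ∈ Col χ u := by
  simp only [Col, Finset.mem_image, Finset.mem_erase]; exact ⟨v, ⟨h, by simp⟩, rfl⟩

lemma goodV {c : ℕ} {x : V} (h1 : c ∈ Col χ x) (h2 : (Col χ x).card ≤ 2) : GoodV χ c x := by
  have h3 : ((Col χ x).erase c).card ≤ 1 := by
    rw [Finset.card_erase_of_mem h1]; omega
  rw [Finset.card_le_one_iff_subset_singleton] at h3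
  obtain ⟨d, hd⟩ := h3
  refine ⟨d, fun y hy => ?_⟩
  by_contra hh
  push Not at hh
  have := hd (Finset.mem_erase.2 ⟨hh.1, mem_col hy⟩)
  simp at this
  exact hh.2 this

lemma common (hs : ∀ u v, χ u v = χ v u) {c : ℕ} [Nonempty V] (h1 : ∀ x, c ∈ Col χ x)
    (h2 : ∀ x, (Col χ x).card ≤ 2) : Good χ := by
  obtain ⟨S, T, k1, k2, k3, k4⟩ := cover hs c (Finset.univ : Finset V)
  obtain ⟨c', hc, hT⟩ := mono hs k4 (Classical.arbitrary V) (fun x _ _ => goodV (h1 x) (h2 x))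
  exact ⟨S, T, c, c', hc.symm, k3, hT, k1, k2⟩

lemma caseA (hs : ∀ u v, χ u v = χ v u) (hn : 2 ≤ Fintype.card V)
    (hsum : ∑ v, (Col χ v).card ≤ 2 * Fintype.card V) {a : V} (ha : (Col χ a).card = 1) :
    Good χ := by
  classical
  obtain ⟨c, hc⟩ := Finset.card_eq_one.1 ha
  have hu : ∀ z, Rc χ c a z := by
    intro z
    by_cases hz : a = z
    · exact Or.inl hz
    · right
      have := mem_col (χ := χ) (u := a) (v := z) (Ne.symm hz)
      rw [hc] at this; simpa using this
  have hcm : ∀ x, c ∈ Col χ x := by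
    intro x
    by_cases hx : x = a
    · subst hx; rw [hc]; simp
    · have h1 := mem_col (χ := χ) (u := x) (v := a) (Ne.symm hx)
      rcases hu x with h | h
      · exact absurd h.symm hx
      · rwa [hs, h] at h1
  have huA : ∀ y, (Col χ y).card = 1 → ∀ z, Rc χ c y z := by
    intro y hy z
    obtain ⟨d, hd⟩ := Finset.card_eq_one.1 hy
    have h1 := hcm y
    rw [hd] at h1
    have h2 : c = d := by simpa using h1
    by_cases hz : y = z
    · exact Or.inl hz
    · right
      have := mem_col (χ := χ) (u := y) (v := z) (Ne.symm hz)
      rw [hd] at this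
      rw [h2]; simpa using this
  set A := Finset.univ.filter (fun v => (Col χ v).card = 1) with hA
  set Bad := Finset.univ.filter (fun v => 3 ≤ (Col χ v).card) with hBad
  have hcard : Bad.card ≤ A.card := by
    have h1 : ∑ v : V, (2 + (if 3 ≤ (Col χ v).card then 1 else 0)) ≤
        ∑ v : V, ((Col χ v).card + (if (Col χ v).card = 1 then 1 else 0)) := by
      refine Finset.sum_le_sum fun v _ => ?_
      have : 0 < (Col χ v).card := Finset.card_pos.2 ⟨c, hcm v⟩
      split_ifs <;> omega
    rw [Finset.sum_add_distrib, Finset.sum_add_distrib, ← Finset.card_filter, ← Finset.card_filter] at h1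
    simp only [Finset.sum_const, smul_eq_mul, Finset.card_univ] at h1
    rw [hA, hBad]; omega
  have haA : a ∈ A := by simp [hA, ha]
  obtain ⟨v0, Bad', A', hB1, hB2, hA', hcd⟩ : ∃ v0 Bad' A', Bad' ⊆ Bad ∧ Bad ⊆ insert v0 Bad' ∧
      A' ⊆ A.erase a ∧ Bad'.card = A'.card := by
    rcases Bad.eq_empty_or_nonempty with h | ⟨v0, h⟩
    · exact ⟨a, ∅, ∅, by simp, by simp [h], by simp, rfl⟩
    · have : (Bad.erase v0).card ≤ (A.erase a).card := by
        rw [Finset.card_erase_of_mem h, Finset.card_erase_of_mem haA]; omega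
      obtain ⟨A', h1, h2⟩ := Finset.exists_subset_card_eq this
      exact ⟨v0, Bad.erase v0, A', Finset.erase_subset _ _, by
        rw [Finset.insert_erase h], h1, h2.symm⟩
  have hdAB : Disjoint Bad' A' := by
    rw [Finset.disjoint_left]
    intro x hx hx'
    have h1 := hB1 hx
    have h2 := Finset.mem_of_mem_erase (hA' hx')
    simp [hA, hBad] at h1 h2
    omega
  have haB' : a ∉ Bad' := fun h => by
    have := hB1 h; simp [hBad] at this; omega
  have haA' : a ∉ A' := fun h => by have := hA' h; simp at this
  obtain ⟨S, T, k1, k2, k3, k4⟩ := cover hs c (Finset.univ \ (Bad' ∪ A'))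
  have hmem : ∀ x, (x ∈ S ∨ x ∈ T) ↔ (x ∉ Bad' ∧ x ∉ A') := by
    intro x
    have : x ∈ S ∪ T ↔ x ∈ Finset.univ \ (Bad' ∪ A') := by rw [k2]
    simpa using this
  rw [Finset.disjoint_left] at k1
  obtain ⟨c', hc', hT⟩ := mono hs k4 v0 (fun x hx hx0 => goodV (hcm x) (by
    by_contra hh
    have h1 : x ∈ Bad := by simp [hBad]; omega
    have h2 := hB2 h1
    have h3 := (hmem x).1 (Or.inr hx)
    simp [hx0] at h2
    exact h3.1 h2))
  have fin : ∀ S T, (∀ x, (x ∈ S ∨ x ∈ T) ↔ (x ∉ Bad' ∧ x ∉ A')) → (∀ x, x ∈ S → x ∉ T) →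
      a ∈ S → Cyc (Rc χ c) S → Cyc (Rc χ c') T → Good χ := by
    intro S T hmem k1 haS h3 h4
    obtain ⟨b, hm, -⟩ := h3.rotate haS
    obtain ⟨u', k5, k6⟩ := insert_pairs (R := Rc χ c) (Rc.symm hs c) _ Bad' A' S a b rfl hcd.symm hdAB
      (by rw [Finset.disjoint_left]; grind) (by rw [Finset.disjoint_left]; grind)
      (fun y hy => huA y (by have := Finset.mem_of_mem_erase (hA' hy); simpa [hA] using this)) hu hm
    refine ⟨_, T, c, c', hc'.symm, k6.cyc (Rc.symm hs _ _ _ (k5 _)), h4, ?_, ?_⟩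
    · rw [Finset.disjoint_left]; grind
    · ext x; simp; grind
  by_cases haT : a ∈ T
  · obtain ⟨b, hm, hr⟩ := k4.rotate haT
    rcases hm.uncons with ⟨h1, h2⟩ | ⟨w, T', h1, h2, h3, h4⟩
    · refine fin (insert a S) ∅ (by intro x; rw [← hmem, h1]; simp; tauto) (by simp) (by simp) ?_
        (Or.inl rfl)
      rcases k3 with rfl | ⟨s, t, hm', hr'⟩
      · simpa using (MP.single a).cyc (hu a)
      · exact (hm'.snoc (c := a) (fun h => k1 h haT) (Rc.symm hs _ _ _ (hu t))).cyc (hu s)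
    · exfalso
      have hne : a ≠ w := by rintro rfl; exact h1 h4.left
      exact h3.resolve_left hne ((hu w).resolve_left hne)
  · exact fin S T hmem (fun x => k1 (a := x)) (((hmem a).2 ⟨haB', haA'⟩).resolve_right haT) k3 hT

end red
end BT

namespace BT
set_option linter.unusedSectionVars false
set_option linter.unusedVariables false

inductive LF {V : Type*} [DecidableEq V] (R : V → V → Prop) : Finset V → ℕ → Prop
  | nil : LF R ∅ 0
  | add {S T : Finset V} {a b : V} {p : ℕ} : MP R S a b → LF R T p → Disjoint S T →
      LF R (S ∪ T) (p + 1)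

section lf
variable {V : Type*} [DecidableEq V] {R B : V → V → Prop}

lemma LF.congr {S T : Finset V} {p q : ℕ} (h : LF R S p) (e : S = T) (e' : p = q) : LF R T q :=
  e ▸ e' ▸ h

lemma LF.append {S T : Finset V} {p q : ℕ} (h : LF R S p) (h' : LF R T q) (hd : Disjoint S T) :
    LF R (S ∪ T) (p + q) := by
  induction h with
  | nil => exact h'.congr (by simp) (by simp)
  | @add S1 S2 a b p h1 h2 h3 ih =>
    rw [Finset.disjoint_union_left] at hd
    exact (LF.add h1 (ih hd.2) (Finset.disjoint_union_right.2 ⟨h3, hd.1⟩)).congr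
      (by rw [Finset.union_assoc]) (by omega)

lemma LF.path {S : Finset V} {a b : V} (h : MP R S a b) : LF R S 1 :=
  (LF.add h LF.nil (by simp)).congr (by simp) rfl

lemma LF.singles (S : Finset V) : LF R S S.card := by
  induction S using Finset.induction_on with
  | empty => exact LF.nil
  | insert a S h ih =>
    exact (LF.add (MP.single a) ih (by simpa using h)).congr (by ext; simp)
      (by rw [Finset.card_insert_of_notMem h])

lemma LF.ofPath {S X : Finset V} {a b : V} (h : MP R S a b) (hS : S ⊆ X) :
    LF R X (1 + X.card - S.card) := by
  have := (LF.path h).append (LF.singles (X \ S)) Finset.disjoint_sdiff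
  refine this.congr (Finset.union_sdiff_of_subset hS) ?_
  have := Finset.card_sdiff_add_card_eq_card hS
  omega

lemma MP.card_pos {S : Finset V} {a b : V} (h : MP R S a b) : 1 ≤ S.card :=
  Finset.card_pos.2 ⟨a, h.left⟩

lemma LF.succ {S : Finset V} {p : ℕ} (h : LF R S p) (hp : p < S.card) : LF R S (p + 1) := by
  induction h with
  | nil => simp at hp
  | @add S T a b p h1 h2 h3 ih =>
    rw [Finset.card_union_of_disjoint h3] at hp
    rcases h1.uncons with ⟨rfl, rfl⟩ | ⟨c, S', k1, rfl, k3, k4⟩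
    · exact LF.add h1 (ih (by simp at hp; omega)) h3
    · rw [Finset.disjoint_insert_left] at h3
      refine (LF.add (MP.single a) (LF.add k4 h2 h3.2) (by simp [k1, h3.1])).congr ?_ rfl
      ext; simp

lemma LF.mono {S : Finset V} {p q : ℕ} (h : LF R S p) (hpq : p ≤ q) (hq : q ≤ S.card) :
    LF R S q := by
  induction q, hpq using Nat.le_induction with
  | base => exact h
  | succ q hq' ih => exact (ih (by omega)).succ (by omega)

lemma LF.join (Rs : ∀ a b, R a b → R b a) (p : ℕ) : ∀ (S T : Finset V), LF R S (p + 1) →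
    LF R T (p + 1) → Disjoint S T → (∀ a ∈ S, ∀ b ∈ T, R a b) →
    ∃ a ∈ S, ∃ b ∈ T, MP R (S ∪ T) a b := by
  induction p with
  | zero =>
    intro S T hS hT hd hc
    cases hS with
    | @add S1 S2 a b _ h1 h2 h3 =>
    cases hT with
    | @add T1 T2 c d _ k1 k2 k3 =>
    cases h2
    cases k2
    simp only [Finset.union_empty] at *
    exact ⟨a, h1.left, d, k1.right, h1.append k1 hd (hc _ h1.right _ k1.left)⟩
  | succ p ih =>
    intro S T hS hT hd hc
    cases hS with
    | @add S1 S2 a b _ h1 h2 h3 =>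
    cases hT with
    | @add T1 T2 c d _ k1 k2 k3 =>
    rw [Finset.disjoint_union_left, Finset.disjoint_union_right, Finset.disjoint_union_right] at hd
    obtain ⟨⟨d1, d2⟩, d3, d4⟩ := hd
    obtain ⟨x, hx, y, hy, hm⟩ := ih S2 T2 h2 k2 d4
      (fun a ha b hb => hc a (by simp [ha]) b (by simp [hb]))
    have m1 := h1.append k1 d1 (hc _ (by simp [h1.right]) _ (by simp [k1.left]))
    have m2 := m1.append hm (by
      simp only [Finset.disjoint_union_left, Finset.disjoint_union_right]
      exact ⟨⟨h3, d3.symm⟩, d2, k3⟩)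
      (Rs _ _ (hc x (by simp [hx]) d (by simp [k1.right])))
    refine ⟨a, by simp [h1.left], y, by simp [hy], m2.congr ?_⟩
    ext z; simp only [Finset.mem_union]; tauto

lemma LF.joinCyc (Rs : ∀ a b, R a b → R b a) {p : ℕ} {S T : Finset V} (hp : 1 ≤ p)
    (hS : LF R S p) (hT : LF R T p) (hd : Disjoint S T) (hc : ∀ a ∈ S, ∀ b ∈ T, R a b) :
    Cyc R (S ∪ T) := by
  obtain ⟨q, rfl⟩ : ∃ q, p = q + 1 := ⟨p - 1, by omega⟩
  obtain ⟨a, ha, b, hb, hm⟩ := LF.join Rs q S T hS hT hd hc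
  exact hm.cyc (Rs _ _ (hc a ha b hb))

lemma MP.trim {S : Finset V} {a b : V} (h : MP R S a b) {m : ℕ} (h1 : 1 ≤ m) (h2 : m ≤ S.card) :
    ∃ S' a', S' ⊆ S ∧ MP R S' a' b ∧ S'.card = m := by
  induction h with
  | single a =>
    simp at h2
    exact ⟨{a}, a, by simp, MP.single a, by simp; omega⟩
  | @cons a b c S k1 k2 k3 ih =>
    by_cases hm : m ≤ S.card
    · obtain ⟨S', a', e1, e2, e3⟩ := ih hm
      exact ⟨S', a', e1.trans (Finset.subset_insert _ _), e2, e3⟩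
    · rw [Finset.card_insert_of_notMem k1] at h2
      exact ⟨insert a S, a, subset_rfl, MP.cons k1 k2 k3, by
        rw [Finset.card_insert_of_notMem k1]; omega⟩

lemma MP.tail {S : Finset V} {a b : V} (h : MP R S a b) (h2 : 2 ≤ S.card) : LF R (S.erase a) 1 := by
  rcases h.uncons with ⟨rfl, rfl⟩ | ⟨c, S', k1, rfl, k3, k4⟩
  · simp at h2
  · exact (LF.path k4).congr (by rw [Finset.erase_insert k1]) rfl

lemma card_RB {S T W : Finset V} {v : V} (h1 : S ∪ T = W) (h2 : S ∩ T = {v}) :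
    S.card + T.card = W.card + 1 := by
  have := Finset.card_union_add_card_inter S T
  rw [h1, h2] at this
  simp at this; omega

lemma split_aux {S W : Finset V} {α β : ℕ} {v b : V} (h : MP R S v b) (hS : S ⊆ W)
    (ha : 1 ≤ α) (hs : α + β ≤ W.card) (hs2 : W.card ≤ β + S.card) :
    ∃ X1 X2, Disjoint X1 X2 ∧ X1 ∪ X2 = W ∧ LF R X1 α ∧ LF B X2 β := by
  obtain ⟨S', a', e1, e2, e3⟩ := h.trim (m := W.card - β) (by omega) (by omega)
  have hc := Finset.card_sdiff_add_card_eq_card (e1.trans hS)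
  refine ⟨S', W \ S', Finset.disjoint_sdiff, Finset.union_sdiff_of_subset (e1.trans hS),
    (LF.path e2).mono ha (by omega), (LF.singles _).congr rfl (by omega)⟩

lemma split (hR : ∀ a b, R a b → R b a) (hB : ∀ a b, B a b → B b a)
    {W : Finset V} (ht : ∀ a ∈ W, ∀ b ∈ W, R a b ∨ B a b) {α β : ℕ} (ha : 1 ≤ α) (hb : 1 ≤ β)
    (hs : α + β ≤ W.card) :
    ∃ X1 X2, Disjoint X1 X2 ∧ X1 ∪ X2 = W ∧ LF R X1 α ∧ LF B X2 β := by
  obtain ⟨S, T, v, a, b, h1, h2, h3, h4⟩ := exists_RB hR hB W (Finset.card_pos.1 (by omega)) ht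
  have hc := card_RB h1 h2
  have hS : S ⊆ W := h1 ▸ Finset.subset_union_left
  have hT : T ⊆ W := h1 ▸ Finset.subset_union_right
  have hmem : ∀ z, z ∈ S → z ∈ T → z = v := by
    intro z hz hz'
    have : z ∈ S ∩ T := Finset.mem_inter.2 ⟨hz, hz'⟩
    rw [h2] at this; simpa using this
  by_cases c1 : T.card < β
  · exact split_aux h3 hS ha hs (by omega)
  by_cases c2 : S.card < α
  · obtain ⟨X2, X1, e1, e2, e3, e4⟩ := split_aux (B := R) (α := β) (β := α) h4 hT hb (by omega) (by omega)
    exact ⟨X1, X2, e1.symm, by rw [Finset.union_comm]; exact e2, e4, e3⟩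
  by_cases c3 : β + 1 ≤ T.card
  · refine ⟨S, T.erase v, ?_, ?_, (LF.path h3).mono ha (by omega), (h4.tail (by omega)).mono hb ?_⟩
    · rw [Finset.disjoint_left]
      intro z hz hz'
      rw [Finset.mem_erase] at hz'
      exact hz'.1 (hmem z hz hz'.2)
    · rw [← h1]; ext z; simp only [Finset.mem_union, Finset.mem_erase]
      have := h3.left
      by_cases hz : z = v
      · subst hz; tauto
      · tauto
    · rw [Finset.card_erase_of_mem h4.left]; omega
  · refine ⟨S.erase v, T, ?_, ?_, (h3.tail (by omega)).mono ha ?_, (LF.path h4).mono hb (by omega)⟩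
    · rw [Finset.disjoint_left]
      intro z hz hz'
      rw [Finset.mem_erase] at hz
      exact hz.1 (hmem z hz.2 hz')
    · rw [← h1]; ext z; simp only [Finset.mem_union, Finset.mem_erase]
      have := h4.left
      by_cases hz : z = v
      · subst hz; tauto
      · tauto
    · rw [Finset.card_erase_of_mem h3.left]; omega

lemma MP.eq_singleton {S : Finset V} {a : V} (h : MP R S a a) : S = {a} := by
  rcases h.uncons with ⟨h, _⟩ | ⟨c, T, h1, h2, h3, h4⟩
  · exact h
  · exact absurd h4.right h1

def TT (R B : V → V → Prop) (X : Finset V) : Prop :=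
  ∃ f1 f2, 1 ≤ f1 ∧ 1 ≤ f2 ∧ LF R X f1 ∧ LF B X f2 ∧
    (f1 + f2 ≤ X.card ∨ (Cyc R X ∧ f1 = 1 ∧ f2 = X.card) ∨ (Cyc B X ∧ f2 = 1 ∧ f1 = X.card))

lemma TT.symm {X : Finset V} (h : TT R B X) : TT B R X := by
  obtain ⟨f1, f2, h1, h2, h3, h4, h5⟩ := h
  refine ⟨f2, f1, h2, h1, h4, h3, ?_⟩
  rcases h5 with h5 | h5 | h5
  · left; omega
  · exact Or.inr (Or.inr h5)
  · exact Or.inr (Or.inl h5)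

lemma tt_aux {X S T : Finset V} {v a b : V} (h1 : S ∪ T = X) (h2 : S ∩ T = {v})
    (h3 : MP R S v a) (h4 : MP B T v b) (h : R a b) (hR : ∀ a b, R a b → R b a) : TT R B X := by
  have hc := card_RB h1 h2
  have hS : S ⊆ X := h1 ▸ Finset.subset_union_left
  have hT : T ⊆ X := h1 ▸ Finset.subset_union_right
  have c1 := h3.card_pos
  have c2 := h4.card_pos
  by_cases hb : b = v
  · subst hb
    have e := h4.eq_singleton
    subst e
    have e : S = X := by
      rw [← h1]; ext z; simp
      rintro rfl; exact h3.left
    subst e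
    exact ⟨1, S.card, le_rfl, c1, LF.path h3, LF.singles _, Or.inr (Or.inl ⟨h3.cyc h, rfl, rfl⟩)⟩
  · have hbS : b ∉ S := by
      intro hbS
      have : b ∈ S ∩ T := Finset.mem_inter.2 ⟨hbS, h4.right⟩
      rw [h2] at this; exact hb (by simpa using this)
    have m := h3.snoc hbS h
    have hsub : insert b S ⊆ X := Finset.insert_subset (hT h4.right) hS
    have hcard := Finset.card_le_card hsub
    have hcT := Finset.card_le_card hT
    rw [Finset.card_insert_of_notMem hbS] at hcard
    have k := LF.ofPath m hsub
    rw [Finset.card_insert_of_notMem hbS] at k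
    exact ⟨_, _, by omega, by omega, k, LF.ofPath h4 hT, Or.inl (by omega)⟩

lemma tt (hR : ∀ a b, R a b → R b a) (hB : ∀ a b, B a b → B b a)
    {X : Finset V} (hX : X.Nonempty) (ht : ∀ a ∈ X, ∀ b ∈ X, R a b ∨ B a b) : TT R B X := by
  obtain ⟨S, T, v, a, b, h1, h2, h3, h4⟩ := exists_RB hR hB X hX ht
  rcases ht a (h1 ▸ Finset.mem_union_left _ h3.right) b (h1 ▸ Finset.mem_union_right _ h4.right) with h | h
  · exact tt_aux h1 h2 h3 h4 h hR
  · exact (tt_aux (by rw [Finset.union_comm]; exact h1) (by rw [Finset.inter_comm]; exact h2) h4 h3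
      (hB _ _ h) hB).symm

end lf

section tri
variable {V : Type*} [DecidableEq V] [Fintype V] {χ : V → V → ℕ}

lemma tri_fin (hs : ∀ u v, χ u v = χ v u) {X Y Z : Finset V} {c1 c2 : ℕ} (hc : c1 ≠ c2)
    (hXY : Disjoint X Y) (hXZ : Disjoint X Z) (hYZ : Disjoint Y Z) (hu : X ∪ Y ∪ Z = Finset.univ)
    (tX : ∀ a ∈ X, ∀ b ∈ X, Rc χ c1 a b ∨ Rc χ c2 a b)
    (eY : ∀ a ∈ X, ∀ b ∈ Y, χ a b = c1) (eZ : ∀ a ∈ X, ∀ b ∈ Z, χ a b = c2) {p q : ℕ}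
    (hp : 1 ≤ p) (hq : 1 ≤ q) (hY : LF (Rc χ c1) Y p) (hZ : LF (Rc χ c2) Z q)
    (hpq : p + q ≤ X.card) : Good χ := by
  obtain ⟨X1, X2, d, rfl, l1, l2⟩ := split (Rc.symm hs c1) (Rc.symm hs c2) tX hp hq hpq
  rw [Finset.disjoint_union_left] at hXY hXZ
  refine ⟨X1 ∪ Y, X2 ∪ Z, c1, c2, hc, LF.joinCyc (Rc.symm hs c1) hp l1 hY hXY.1 ?_,
    LF.joinCyc (Rc.symm hs c2) hq l2 hZ hXZ.2 ?_, ?_, ?_⟩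
  · exact fun a ha b hb => Or.inr (eY a (by simp [ha]) b hb)
  · exact fun a ha b hb => Or.inr (eZ a (by simp [ha]) b hb)
  · simp only [Finset.disjoint_union_left, Finset.disjoint_union_right]
    exact ⟨⟨d, hXY.2.symm⟩, hXZ.1, hYZ⟩
  · rw [← hu]; ext z; simp only [Finset.mem_union]; tauto

lemma good_of {S T : Finset V} {c c' : ℕ} (hc : c ≠ c') (hS : Cyc (Rc χ c) S)
    (hT : Cyc (Rc χ c') T) (hd : Disjoint S T) (hu : ∀ z, z ∈ S ∨ z ∈ T) : Good χ :=
  ⟨S, T, c, c', hc, hS, hT, hd, by ext z; simpa using hu z⟩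

lemma tri (hs : ∀ u v, χ u v = χ v u) {X Y Z : Finset V} {c1 c2 c3 : ℕ} (h12 : c1 ≠ c2)
    (h13 : c1 ≠ c3) (h23 : c2 ≠ c3) (nX : X.Nonempty) (nY : Y.Nonempty) (nZ : Z.Nonempty)
    (hXY : Disjoint X Y) (hXZ : Disjoint X Z) (hYZ : Disjoint Y Z) (hu : ∀ z, z ∈ X ∨ z ∈ Y ∨ z ∈ Z)
    (tX : ∀ a ∈ X, ∀ b ∈ X, Rc χ c1 a b ∨ Rc χ c2 a b)
    (tY : ∀ a ∈ Y, ∀ b ∈ Y, Rc χ c1 a b ∨ Rc χ c3 a b)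
    (tZ : ∀ a ∈ Z, ∀ b ∈ Z, Rc χ c2 a b ∨ Rc χ c3 a b)
    (eXY : ∀ a ∈ X, ∀ b ∈ Y, χ a b = c1) (eXZ : ∀ a ∈ X, ∀ b ∈ Z, χ a b = c2)
    (eYZ : ∀ a ∈ Y, ∀ b ∈ Z, χ a b = c3) : Good χ := by
  obtain ⟨x1, x2, x1p, x2p, lx1, lx2, hx⟩ := tt (Rc.symm hs c1) (Rc.symm hs c2) nX tX
  obtain ⟨y1, y3, y1p, y3p, ly1, ly3, hy⟩ := tt (Rc.symm hs c1) (Rc.symm hs c3) nY tY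
  obtain ⟨z2, z3, z2p, z3p, lz2, lz3, hz⟩ := tt (Rc.symm hs c2) (Rc.symm hs c3) nZ tZ
  have eYX : ∀ a ∈ Y, ∀ b ∈ X, χ a b = c1 := fun a ha b hb => by rw [hs]; exact eXY b hb a ha
  have eZX : ∀ a ∈ Z, ∀ b ∈ X, χ a b = c2 := fun a ha b hb => by rw [hs]; exact eXZ b hb a ha
  have eZY : ∀ a ∈ Z, ∀ b ∈ Y, χ a b = c3 := fun a ha b hb => by rw [hs]; exact eYZ b hb a ha
  by_cases k1 : y1 + z2 ≤ X.card
  · exact tri_fin hs h12 hXY hXZ hYZ (by ext z; rcases hu z with h | h | h <;> simp [h]) tX eXY eXZ y1p z2p ly1 lz2 k1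
  by_cases k2 : x1 + z3 ≤ Y.card
  · exact tri_fin hs h13 hXY.symm hYZ hXZ (by ext z; rcases hu z with h | h | h <;> simp [h]) tY eYX eYZ x1p z3p lx1 lz3 k2
  by_cases k3 : x2 + y3 ≤ Z.card
  · exact tri_fin hs h23 hXZ.symm hYZ.symm hXY (by ext z; rcases hu z with h | h | h <;> simp [h]) tZ eZX eZY x2p y3p lx2 ly3 k3
  have jXY : LF (Rc χ c1) X 1 → LF (Rc χ c1) Y 1 → Cyc (Rc χ c1) (X ∪ Y) := fun h h' =>
    LF.joinCyc (Rc.symm hs c1) le_rfl h h' hXY (fun a ha b hb => Or.inr (eXY a ha b hb))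
  have jXZ : LF (Rc χ c2) X 1 → LF (Rc χ c2) Z 1 → Cyc (Rc χ c2) (X ∪ Z) := fun h h' =>
    LF.joinCyc (Rc.symm hs c2) le_rfl h h' hXZ (fun a ha b hb => Or.inr (eXZ a ha b hb))
  have jYZ : ∀ p, 1 ≤ p → LF (Rc χ c3) Y p → LF (Rc χ c3) Z p → Cyc (Rc χ c3) (Y ∪ Z) :=
    fun p hp h h' =>
    LF.joinCyc (Rc.symm hs c3) hp h h' hYZ (fun a ha b hb => Or.inr (eYZ a ha b hb))
  have dXY : Disjoint (X ∪ Y) Z := Finset.disjoint_union_left.2 ⟨hXZ, hYZ⟩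
  have dXZ : Disjoint (X ∪ Z) Y := Finset.disjoint_union_left.2 ⟨hXY, hYZ.symm⟩
  have dYZ : Disjoint (Y ∪ Z) X := Finset.disjoint_union_left.2 ⟨hXY.symm, hXZ.symm⟩
  have uXY : ∀ z, z ∈ X ∪ Y ∨ z ∈ Z := fun z => by rcases hu z with h | h | h <;> simp [h]
  have uXZ : ∀ z, z ∈ X ∪ Z ∨ z ∈ Y := fun z => by rcases hu z with h | h | h <;> simp [h]
  have uYZ : ∀ z, z ∈ Y ∪ Z ∨ z ∈ X := fun z => by rcases hu z with h | h | h <;> simp [h]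
  have jE : Y.card = Z.card → Cyc (Rc χ c3) (Y ∪ Z) := fun h =>
    jYZ Y.card (Finset.card_pos.2 nY) (LF.singles _) ((LF.singles _).congr rfl h.symm)
  rcases hx with hx | ⟨cx, hx, hx'⟩ | ⟨cx, hx, hx'⟩
  · omega
  · rcases hy with hy | ⟨cy, hy, hy'⟩ | ⟨cy, hy, hy'⟩
    · omega
    · subst hx hy
      rcases hz with hz | ⟨cz, hz, hz'⟩ | ⟨cz, hz, hz'⟩
      · omega
      · exact good_of h12 (jXY lx1 ly1) cz dXY uXY
      · exact good_of h13 (jXY lx1 ly1) cz dXY uXY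
    · rcases hz with hz | ⟨cz, hz, hz'⟩ | ⟨cz, hz, hz'⟩
      · omega
      · exact good_of h13.symm (jE (by omega)) cx dYZ uYZ
      · subst hy hz
        exact good_of h13.symm (jYZ 1 le_rfl ly3 lz3) cx dYZ uYZ
  · rcases hz with hz | ⟨cz, hz, hz'⟩ | ⟨cz, hz, hz'⟩
    · omega
    · subst hx hz
      rcases hy with hy | ⟨cy, hy, hy'⟩ | ⟨cy, hy, hy'⟩
      · omega
      · exact good_of h12.symm (jXZ lx2 lz2) cy dXZ uXZ
      · exact good_of h23 (jXZ lx2 lz2) cy dXZ uXZ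
    · rcases hy with hy | ⟨cy, hy, hy'⟩ | ⟨cy, hy, hy'⟩
      · omega
      · exact good_of h23.symm (jE (by omega)) cx dYZ uYZ
      · subst hy hz
        exact good_of h23.symm (jYZ 1 le_rfl ly3 lz3) cx dYZ uYZ

end tri
end BT

namespace BT
set_option linter.unusedSectionVars false
set_option linter.unusedVariables false
section fin
variable {V : Type*} [DecidableEq V] [Fintype V] {χ : V → V → ℕ}

lemma eq_pair {S : Finset ℕ} {a b : ℕ} (h : S.card = 2) (ha : a ∈ S) (hb : b ∈ S) (hab : a ≠ b) :
    S = {a, b} := by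
  symm
  apply Finset.eq_of_subset_of_card_le
  · intro z hz; simp at hz; rcases hz with rfl | rfl <;> assumption
  · rw [h, Finset.card_pair hab]

lemma caseB (hs : ∀ u v, χ u v = χ v u) [Nonempty V] (h2 : ∀ x, (Col χ x).card = 2) : Good χ := by
  by_cases hcom : ∃ c, ∀ x, c ∈ Col χ x
  · obtain ⟨c, hc⟩ := hcom
    exact common hs hc (fun x => (h2 x).le)
  push Not at hcom
  have hin : ∀ x y, ∃ d, d ∈ Col χ x ∧ d ∈ Col χ y := by
    intro x y
    by_cases hxy : x = y
    · subst hxy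
      obtain ⟨d, hd⟩ := Finset.card_pos.1 (by rw [h2 x]; omega : 0 < (Col χ x).card)
      exact ⟨d, hd, hd⟩
    · exact ⟨χ x y, mem_col (Ne.symm hxy), by rw [hs]; exact mem_col hxy⟩
  obtain ⟨v⟩ := ‹Nonempty V›
  obtain ⟨c1, c2, h12, hv⟩ := Finset.card_eq_two.1 (h2 v)
  obtain ⟨u, hu⟩ := hcom c1
  obtain ⟨w, hw⟩ := hcom c2
  have hu2 : c2 ∈ Col χ u := by
    obtain ⟨d, d1, d2⟩ := hin v u
    rw [hv] at d1; simp at d1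
    rcases d1 with rfl | rfl
    · exact absurd d2 hu
    · exact d2
  have hw1 : c1 ∈ Col χ w := by
    obtain ⟨d, d1, d2⟩ := hin v w
    rw [hv] at d1; simp at d1
    rcases d1 with rfl | rfl
    · exact d2
    · exact absurd d2 hw
  obtain ⟨c3, h3u, h3w⟩ := hin u w
  have h13 : c1 ≠ c3 := by rintro rfl; exact hu h3u
  have h23 : c2 ≠ c3 := by rintro rfl; exact hw h3w
  have eu := eq_pair (h2 u) hu2 h3u h23
  have ew := eq_pair (h2 w) hw1 h3w h13
  have tri3 : ∀ x, Col χ x = {c1, c2} ∨ Col χ x = {c1, c3} ∨ Col χ x = {c2, c3} := by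
    intro x
    obtain ⟨d, d1, d2⟩ := hin v x
    obtain ⟨e, e1, e2⟩ := hin u x
    obtain ⟨f, f1, f2⟩ := hin w x
    rw [hv] at d1; rw [eu] at e1; rw [ew] at f1
    simp only [Finset.mem_insert, Finset.mem_singleton] at d1 e1 f1
    have m12 : c1 ∈ Col χ x ∨ c2 ∈ Col χ x := by
      rcases d1 with h | h
      · left; rw [← h]; exact d2
      · right; rw [← h]; exact d2
    have m23 : c2 ∈ Col χ x ∨ c3 ∈ Col χ x := by
      rcases e1 with h | h
      · left; rw [← h]; exact e2
      · right; rw [← h]; exact e2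
    have m13 : c1 ∈ Col χ x ∨ c3 ∈ Col χ x := by
      rcases f1 with h | h
      · left; rw [← h]; exact f2
      · right; rw [← h]; exact f2
    by_cases q1 : c1 ∈ Col χ x
    · rcases m23 with q | q
      · exact Or.inl (eq_pair (h2 x) q1 q h12)
      · exact Or.inr (Or.inl (eq_pair (h2 x) q1 q h13))
    · exact Or.inr (Or.inr (eq_pair (h2 x) (m12.resolve_left q1) (m13.resolve_left q1) h23))
  have hmem : ∀ x y, x ≠ y → χ x y ∈ Col χ x ∧ χ x y ∈ Col χ y := fun x y hxy =>
    ⟨mem_col (Ne.symm hxy), by rw [hs]; exact mem_col hxy⟩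
  have n1 : ∀ x, Col χ x = {c1, c2} → Col χ x = {c1, c3} → False := by
    intro x a b
    have : c2 ∈ Col χ x := by rw [a]; simp
    rw [b] at this; simp at this; omega
  have n2 : ∀ x, Col χ x = {c1, c2} → Col χ x = {c2, c3} → False := by
    intro x a b
    have : c1 ∈ Col χ x := by rw [a]; simp
    rw [b] at this; simp at this; omega
  have n3 : ∀ x, Col χ x = {c1, c3} → Col χ x = {c2, c3} → False := by
    intro x a b
    have : c1 ∈ Col χ x := by rw [a]; simp
    rw [b] at this; simp at this; omega
  refine tri hs (X := Finset.univ.filter (fun x => Col χ x = {c1, c2}))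
    (Y := Finset.univ.filter (fun x => Col χ x = {c1, c3}))
    (Z := Finset.univ.filter (fun x => Col χ x = {c2, c3})) h12 h13 h23
    ⟨v, by simp [hv]⟩ ⟨w, by simp [ew]⟩ ⟨u, by simp [eu]⟩ ?_ ?_ ?_ ?_ ?_ ?_ ?_ ?_ ?_ ?_ <;>
    simp only [Finset.disjoint_left, Finset.mem_filter, Finset.mem_univ, true_and]
  · exact fun x a b => n1 x a b
  · exact fun x a b => n2 x a b
  · exact fun x a b => n3 x a b
  · exact tri3
  · intro a ha b hb
    by_cases hab : a = b
    · exact Or.inl (Or.inl hab)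
    · have := (hmem a b hab).1
      rw [ha] at this; simp at this
      exact this.imp Or.inr Or.inr
  · intro a ha b hb
    by_cases hab : a = b
    · exact Or.inl (Or.inl hab)
    · have := (hmem a b hab).1
      rw [ha] at this; simp at this
      exact this.imp Or.inr Or.inr
  · intro a ha b hb
    by_cases hab : a = b
    · exact Or.inl (Or.inl hab)
    · have := (hmem a b hab).1
      rw [ha] at this; simp at this
      exact this.imp Or.inr Or.inr
  · intro a ha b hb
    have := hmem a b (by rintro rfl; exact n1 _ ha hb)
    rw [ha, hb] at this; simp at this; omega
  · intro a ha b hb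
    have := hmem a b (by rintro rfl; exact n2 _ ha hb)
    rw [ha, hb] at this; simp at this; omega
  · intro a ha b hb
    have := hmem a b (by rintro rfl; exact n3 _ ha hb)
    rw [ha, hb] at this; simp at this; omega

lemma good (hs : ∀ u v, χ u v = χ v u) (hsum : ∑ v, (Col χ v).card ≤ 2 * Fintype.card V) :
    Good χ := by
  by_cases hn : 2 ≤ Fintype.card V
  · have hne : Nonempty V := Fintype.card_pos_iff.1 (by omega)
    by_cases ha : ∃ a, (Col χ a).card = 1
    · obtain ⟨a, ha⟩ := ha
      exact caseA hs hn hsum ha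
    · push Not at ha
      have hpos : ∀ x, 0 < (Col χ x).card := by
        intro x
        obtain ⟨y, hy⟩ := Fintype.exists_ne_of_one_lt_card (by omega) x
        exact Finset.card_pos.2 ⟨_, mem_col hy⟩
      have hge : ∀ x ∈ Finset.univ, 2 ≤ (Col χ x).card := by
        intro x _
        have := hpos x; have := ha x; omega
      have hsum2 : ∑ x : V, 2 = ∑ v, (Col χ v).card := by
        refine le_antisymm (Finset.sum_le_sum hge) ?_
        simp; omega
      have := (Finset.sum_eq_sum_iff_of_le hge).1 hsum2
      exact caseB hs (fun x => (this x (Finset.mem_univ _)).symm)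
  · refine ⟨Finset.univ, ∅, 0, 1, by omega, ?_, Or.inl rfl, by simp, by simp⟩
    rcases isEmpty_or_nonempty V with h | ⟨⟨a⟩⟩
    · left; exact Finset.univ_eq_empty
    · have : Finset.univ = {a} := by
        symm
        apply Finset.eq_of_subset_of_card_le (by simp)
        rw [Finset.card_univ]; simp; omega
      rw [this]
      exact (MP.single a).cyc (Or.inl rfl)

end fin

section conv
variable {n : ℕ} {χ : Fin n → Fin n → ℕ}

lemma toWalk (hs : ∀ u v, χ u v = χ v u) {c : ℕ} {S : Finset (Fin n)} {a b : Fin n}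
    (h : MP (Rc χ c) S a b) : ∃ p : (⊤ : SimpleGraph (Fin n)).Walk a b, p.IsPath ∧
      p.support.toFinset = S ∧ ∀ x y, s(x, y) ∈ p.edges → χ x y = c := by
  induction h with
  | single a => exact ⟨SimpleGraph.Walk.nil, by simp, by simp, by simp⟩
  | @cons a b e S h1 h2 h3 ih =>
    obtain ⟨p, hp, hS, he⟩ := ih
    have hne : a ≠ b := by rintro rfl; exact h1 h3.left
    have hadj : (⊤ : SimpleGraph (Fin n)).Adj a b := by simpa using hne
    refine ⟨SimpleGraph.Walk.cons hadj p, ?_, ?_, ?_⟩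
    · rw [SimpleGraph.Walk.cons_isPath_iff]
      refine ⟨hp, fun h => h1 ?_⟩
      rw [← hS]; simpa using h
    · simp [hS]
    · intro x y hxy
      simp only [SimpleGraph.Walk.edges_cons, List.mem_cons] at hxy
      rcases hxy with h | h
      · have hc := h2.resolve_left hne
        rw [Sym2.eq_iff] at h
        rcases h with ⟨rfl, rfl⟩ | ⟨rfl, rfl⟩
        · exact hc
        · rw [hs]; exact hc
      · exact he x y h

lemma toMono (hs : ∀ u v, χ u v = χ v u) {c : ℕ} {S : Finset (Fin n)}
    (h : Cyc (Rc χ c) S) : IsMonoCycle χ c S := by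
  rcases h with rfl | ⟨a, b, hm, hr⟩
  · exact Or.inl rfl
  rcases hm.uncons with ⟨rfl, rfl⟩ | ⟨w, T, h1, rfl, h3, h4⟩
  · exact Or.inr (Or.inl ⟨b, rfl⟩)
  have haw : a ≠ w := by rintro rfl; exact h1 h4.left
  have hab : b ≠ a := by rintro rfl; exact h1 h4.right
  by_cases hwb : w = b
  · subst hwb
    rw [h4.eq_singleton]
    exact Or.inr (Or.inr (Or.inl ⟨a, w, haw, rfl, h3.resolve_left haw⟩))
  · obtain ⟨p, hp, hS, he⟩ := toWalk hs h4
    have hadj : (⊤ : SimpleGraph (Fin n)).Adj a w := by simpa using haw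
    have hadj' : (⊤ : SimpleGraph (Fin n)).Adj b a := by simpa using hab
    have hap : a ∉ p.support := fun h => h1 (by rw [← hS]; simpa using h)
    refine Or.inr (Or.inr (Or.inr ⟨a, SimpleGraph.Walk.cons hadj (p.concat hadj'), ?_, ?_, ?_⟩))
    · rw [SimpleGraph.Walk.cons_isCycle_iff]
      refine ⟨hp.concat hap hadj', ?_⟩
      rw [SimpleGraph.Walk.edges_concat]
      simp only [List.concat_eq_append, List.mem_append, List.mem_singleton, not_or]
      refine ⟨fun h => hap (p.fst_mem_support_of_mem_edges h), fun h => ?_⟩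
      rw [Sym2.eq_iff] at h
      rcases h with ⟨h, _⟩ | ⟨_, h⟩
      · exact hab h.symm
      · exact hwb h
    · rw [SimpleGraph.Walk.support_cons, SimpleGraph.Walk.support_concat]
      ext z
      have : z ∈ p.support.toFinset ↔ z ∈ T := by rw [hS]
      simp at this ⊢
      tauto
    · intro x y hxy
      rw [SimpleGraph.Walk.edges_cons, SimpleGraph.Walk.edges_concat] at hxy
      simp only [List.concat_eq_append, List.mem_append, List.mem_cons, List.mem_singleton,
        List.not_mem_nil, or_false] at hxy
      have hc := h3.resolve_left haw
      have hc' := hr.resolve_left hab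
      rcases hxy with h | h | h
      · rw [Sym2.eq_iff] at h
        rcases h with ⟨rfl, rfl⟩ | ⟨rfl, rfl⟩
        · exact hc
        · rw [hs]; exact hc
      · exact he x y h
      · rw [Sym2.eq_iff] at h
        rcases h with ⟨rfl, rfl⟩ | ⟨rfl, rfl⟩
        · exact hc'
        · rw [hs]; exact hc'
end conv
end BT

/-- If `K_n` is `2`-mean coloured, i.e. the sum over all vertices of the number of colours
incident to that vertex is at most `2n`, then the vertex set can be covered by two disjoint
monochromatic cycles of different colours. -/
theorem two_mean_colouring_two_cycles (n : ℕ) (χ : Fin n → Fin n → ℕ)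
    (hsymm : ∀ u v, χ u v = χ v u)
    (hmean : ∑ v : Fin n, ((Finset.univ.erase v).image (χ v)).card ≤ 2 * n) :
    ∃ (S₁ S₂ : Finset (Fin n)) (c₁ c₂ : ℕ), c₁ ≠ c₂ ∧
      IsMonoCycle χ c₁ S₁ ∧ IsMonoCycle χ c₂ S₂ ∧
      Disjoint S₁ S₂ ∧ S₁ ∪ S₂ = Finset.univ := by
  obtain ⟨S, T, c, c', h1, h2, h3, h4, h5⟩ := BT.good (χ := χ) hsymm (by
    rw [Fintype.card_fin]; exact hmean)
  exact ⟨S, T, c, c', h1, BT.toMono hsymm h2, BT.toMono hsymm h3, h4, h5⟩
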